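/- arXiv:1903.04331 — 3 statements merged into one kernel-verified Lean document; each statement's English description precedes it below -/
import Mathlib

section
/- For every p ∈ [1, ∞) there exists a constant C_p > 0 (depending only on p) such that: for every n ≥ 1, every r ∈ [0, 1), every finite sequence σ = (λ_1, …, λ_n) ∈ D^n with max_i |λ_i| ≤ r, and every f ∈ Hol(D) with ‖f‖_{H^p} ≤ 1 and ‖f‖_{H^∞} < ∞, there exists g ∈ H^∞ interpolating f on σ with ‖g‖_{H^∞} ≤ C_p · (n/(1−r))^{1/p}. (Upper bound in Theorem 2.1, Hardy case.) -/
open Complex Metric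

noncomputable section

/-- The elementary Blaschke factor `b_λ(z) = (λ - z)/(1 - conj(λ) z)`. -/
def blaschkeF (l z : ℂ) : ℂ := (l - z) / (1 - (starRingEnd ℂ) l * z)

/-- Up to constants, `kernelMajorant N s` is `min N (1 / |sin s|)`. -/
def kernelMajorant (N s : ℝ) : ℝ := 2 * N / (1 + N * |Real.sin s| / 6)

lemma kernelMajorant_nonneg {N : ℝ} (hN : 0 ≤ N) (s : ℝ) : 0 ≤ kernelMajorant N s := by
  unfold kernelMajorant; positivity

lemma kernelMajorant_le {N : ℝ} (hN : 0 ≤ N) (s : ℝ) : kernelMajorant N s ≤ 2 * N := by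
  unfold kernelMajorant
  refine div_le_self (by positivity) ?_
  have : 0 ≤ N * |Real.sin s| / 6 := by positivity
  linarith

lemma continuous_kernelMajorant {N : ℝ} (hN : 0 ≤ N) : Continuous (kernelMajorant N) := by
  unfold kernelMajorant
  refine Continuous.div (by fun_prop) (by fun_prop) fun s => ?_
  positivity

lemma le_kernelMajorant {N K s : ℝ} (hN : 0 ≤ N) (h₁ : K ≤ N) (h₂ : K * |Real.sin s| ≤ 6) :
    K ≤ kernelMajorant N s := by
  unfold kernelMajorant
  rw [le_div_iff₀ (by positivity)]
  nlinarith [mul_le_mul_of_nonneg_left h₂ hN]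

lemma integral_one_add_mul_rpow_neg_le {c q a : ℝ} (hc : 0 < c) (hq : 1 < q) (ha : 0 ≤ a) :
    ∫ x in (0:ℝ)..a, (1 + c * x) ^ (-q) ≤ 1 / (c * (q - 1)) := by
  have h := intervalIntegral.integral_comp_add_mul (a := 0) (b := a)
    (fun x : ℝ => x ^ (-q)) hc.ne' 1
  have hca : 0 ≤ c * a := by positivity
  rw [h, integral_rpow]
  · have h1 : (0:ℝ) ≤ (1 + c * a) ^ (-q + 1) := by positivity
    have hq' : 0 < q - 1 := by linarith
    simp only [mul_zero, add_zero, Real.one_rpow, smul_eq_mul]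
    have : c⁻¹ * (((1 + c * a) ^ (-q + 1) - 1) / (-q + 1))
        = (1 - (1 + c * a) ^ (-q + 1)) / (c * (q - 1)) := by
      have : -q + 1 = -(q - 1) := by ring
      rw [this]
      field_simp
      ring
    rw [this]
    gcongr
    linarith
  · right
    refine ⟨by linarith, ?_⟩
    rw [Set.uIcc_of_le (by linarith)]
    simp only [Set.mem_Icc, not_and, not_le]
    intro h
    linarith

lemma kernelMajorant_periodic (N : ℝ) : Function.Periodic (kernelMajorant N) Real.pi := by
  intro s
  simp [kernelMajorant, Real.sin_add_pi]

lemma integral_kernelMajorant_rpow_quarter_le {N q : ℝ} (hN : 0 < N) (hq : 1 < q) :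
    ∫ s in (0:ℝ)..(Real.pi / 2), kernelMajorant N s ^ q
      ≤ 2 ^ q * (3 * Real.pi) / (q - 1) * N ^ (q - 1) := by
  have hpi := Real.pi_pos
  have hc : 0 < N / (3 * Real.pi) := by positivity
  have hbound : ∀ s ∈ Set.Icc (0:ℝ) (Real.pi / 2), kernelMajorant N s ^ q
      ≤ (2 * N) ^ q * (1 + N / (3 * Real.pi) * s) ^ (-q) := by
    intro s hs
    have hs0 : 0 ≤ s := hs.1
    rw [Real.rpow_neg (by positivity), ← div_eq_mul_inv, ← Real.div_rpow (by positivity)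
      (by positivity)]
    refine Real.rpow_le_rpow (kernelMajorant_nonneg hN.le s) ?_ (by linarith)
    unfold kernelMajorant
    have hsin := (Real.mul_le_sin hs.1 hs.2).trans (le_abs_self _)
    have : N / (3 * Real.pi) * s = N * (2 / Real.pi * s) / 6 := by field_simp; ring
    rw [this]
    gcongr
  have hcont : ContinuousOn (fun s => (2 * N) ^ q * (1 + N / (3 * Real.pi) * s) ^ (-q))
      (Set.uIcc 0 (Real.pi / 2)) := by
    rw [Set.uIcc_of_le (by positivity)]
    refine continuousOn_const.mul (ContinuousOn.rpow_const (by fun_prop) fun s hs => Or.inl ?_)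
    have hs0 : 0 ≤ s := hs.1
    positivity
  calc ∫ s in (0:ℝ)..(Real.pi / 2), kernelMajorant N s ^ q
      ≤ ∫ s in (0:ℝ)..(Real.pi / 2), (2 * N) ^ q * (1 + N / (3 * Real.pi) * s) ^ (-q) := by
        refine intervalIntegral.integral_mono_on (by positivity) ?_ hcont.intervalIntegrable hbound
        exact ((continuous_kernelMajorant hN.le).rpow_const
          fun s => Or.inr (by linarith)).intervalIntegrable _ _
    _ ≤ (2 * N) ^ q * (1 / (N / (3 * Real.pi) * (q - 1))) := by
        rw [intervalIntegral.integral_const_mul]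
        gcongr
        exact integral_one_add_mul_rpow_neg_le hc hq (by positivity)
    _ = 2 ^ q * (3 * Real.pi) / (q - 1) * N ^ (q - 1) := by
        have hq' : q - 1 ≠ 0 := by linarith
        rw [Real.mul_rpow (by positivity) hN.le, Real.rpow_sub_one hN.ne']
        field_simp

lemma integral_kernelMajorant_rpow_le {N q : ℝ} (hN : 0 < N) (hq : 1 < q) (φ : ℝ) :
    ∫ θ in (0:ℝ)..(2 * Real.pi), kernelMajorant N (θ - φ) ^ q
      ≤ 4 * (2 ^ q * (3 * Real.pi) / (q - 1)) * N ^ (q - 1) := by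
  have hcont : Continuous fun s => kernelMajorant N s ^ q :=
    (continuous_kernelMajorant hN.le).rpow_const fun s => Or.inr (by linarith)
  have hint : ∀ a b, IntervalIntegrable (fun s => kernelMajorant N s ^ q)
      MeasureTheory.volume a b := fun a b => hcont.intervalIntegrable a b
  have hper : Function.Periodic (fun s => kernelMajorant N s ^ q) Real.pi := fun s => by
    simp only [kernelMajorant_periodic N s]
  rw [intervalIntegral.integral_comp_sub_right (fun s => kernelMajorant N s ^ q) φ]
  have h1 := hper.intervalIntegral_add_zsmul_eq 2 (0 - φ) hint
  have e1 : 0 - φ + (2:ℤ) • Real.pi = 2 * Real.pi - φ := by simp; ring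
  have h2 := hper.intervalIntegral_add_eq (0 - φ) (-(Real.pi / 2))
  have e2 : -(Real.pi / 2) + Real.pi = Real.pi / 2 := by ring
  rw [e1] at h1
  rw [e2] at h2
  have h3 : ∫ s in (-(Real.pi / 2))..0, kernelMajorant N s ^ q
      = ∫ s in (0:ℝ)..(Real.pi / 2), kernelMajorant N s ^ q := by
    have := intervalIntegral.integral_comp_neg (a := 0) (b := Real.pi / 2)
      (fun s => kernelMajorant N s ^ q)
    rw [neg_zero] at this
    rw [← this]
    simp [kernelMajorant]
  rw [h1, h2, ← intervalIntegral.integral_add_adjacent_intervals (hint _ 0) (hint 0 _), h3]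
  have h4 := integral_kernelMajorant_rpow_quarter_le hN hq
  simp only [zsmul_eq_mul, Int.cast_ofNat]
  linarith

lemma exists_integral_mul_kernelMajorant_le {p : ℝ} (hp : 1 ≤ p) :
    ∃ C : ℝ, 0 < C ∧ ∀ N : ℝ, 0 < N → ∀ φ : ℝ, ∀ F : ℝ → ℝ, Continuous F → (∀ θ, 0 ≤ F θ) →
      (2 * Real.pi)⁻¹ * ∫ θ in (0:ℝ)..(2 * Real.pi), F θ ^ p ≤ 1 →
      ∫ θ in (0:ℝ)..(2 * Real.pi), F θ * kernelMajorant N (θ - φ) ≤ C * N ^ (1 / p) := by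
  have hpi := Real.pi_pos
  have key : ∀ F : ℝ → ℝ, (2 * Real.pi)⁻¹ * ∫ θ in (0:ℝ)..(2 * Real.pi), F θ ^ p ≤ 1 →
      ∫ θ in (0:ℝ)..(2 * Real.pi), F θ ^ p ≤ 2 * Real.pi := fun F h => by
    rwa [inv_mul_le_iff₀ (by positivity), mul_one] at h
  rcases hp.eq_or_lt with rfl | hp1
  · refine ⟨4 * Real.pi, by positivity, fun N hN φ F hF hF0 hFp => ?_⟩
    have hF1 := key F hFp
    simp only [Real.rpow_one] at hF1
    have hP := continuous_kernelMajorant hN.le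
    calc ∫ θ in (0:ℝ)..(2 * Real.pi), F θ * kernelMajorant N (θ - φ)
        ≤ ∫ θ in (0:ℝ)..(2 * Real.pi), F θ * (2 * N) := by
          refine intervalIntegral.integral_mono_on (by positivity)
            (Continuous.intervalIntegrable (by fun_prop) _ _)
            (Continuous.intervalIntegrable (by fun_prop) _ _) fun θ _ => ?_
          exact mul_le_mul_of_nonneg_left (kernelMajorant_le hN.le _) (hF0 θ)
      _ ≤ 2 * Real.pi * (2 * N) := by
          rw [intervalIntegral.integral_mul_const]
          gcongr
      _ = 4 * Real.pi * N ^ ((1:ℝ) / 1) := by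
          rw [div_one, Real.rpow_one]; ring
  · have hpq : p.HolderConjugate (p / (p - 1)) := Real.HolderConjugate.conjExponent hp1
    set q := p / (p - 1) with hq
    have hq1 : 1 < q := hpq.symm.lt
    have hq0 : 0 < q - 1 := by linarith
    have hp0 : 0 < p := by linarith
    refine ⟨2 * Real.pi / p + 4 * (2 ^ q * (3 * Real.pi) / (q - 1)) / q, by positivity,
      fun N hN φ F hF hF0 hFp => ?_⟩
    have hF1 := key F hFp
    have hP := continuous_kernelMajorant hN.le
    have hFpc : Continuous fun θ => F θ ^ p := hF.rpow_const fun θ => Or.inr hp0.le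
    have hPc : Continuous fun θ => kernelMajorant N (θ - φ) ^ q :=
      (hP.comp (continuous_sub_right φ)).rpow_const fun θ => Or.inr (by linarith)
    have hNp : 0 < N ^ (1 / p) := by positivity
    have hexp : (N ^ (1 / p)) ^ q = N ^ (q - 1) := by
      rw [← Real.rpow_mul hN.le]
      congr 1
      rw [hq]
      field_simp
      ring
    have hpt : ∀ θ, F θ * kernelMajorant N (θ - φ) ≤ N ^ (1 / p) *
        (F θ ^ p / p + kernelMajorant N (θ - φ) ^ q * ((N ^ (q - 1))⁻¹ / q)) := by
      intro θ
      have hP0 := kernelMajorant_nonneg hN.le (θ - φ)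
      have hy := Real.young_inequality_of_nonneg (hF0 θ)
        (div_nonneg hP0 hNp.le) hpq
      rw [Real.div_rpow hP0 hNp.le, hexp] at hy
      calc F θ * kernelMajorant N (θ - φ)
          = N ^ (1 / p) * (F θ * (kernelMajorant N (θ - φ) / N ^ (1 / p))) := by
            field_simp
        _ ≤ _ := by
            refine mul_le_mul_of_nonneg_left (hy.trans_eq ?_) hNp.le
            ring
    calc ∫ θ in (0:ℝ)..(2 * Real.pi), F θ * kernelMajorant N (θ - φ)
        ≤ ∫ θ in (0:ℝ)..(2 * Real.pi), N ^ (1 / p) *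
          (F θ ^ p / p + kernelMajorant N (θ - φ) ^ q * ((N ^ (q - 1))⁻¹ / q)) :=
          intervalIntegral.integral_mono_on (by positivity)
            (Continuous.intervalIntegrable (by fun_prop) _ _)
            (Continuous.intervalIntegrable (by fun_prop) _ _) fun θ _ => hpt θ
      _ = N ^ (1 / p) * ((∫ θ in (0:ℝ)..(2 * Real.pi), F θ ^ p) / p +
          (∫ θ in (0:ℝ)..(2 * Real.pi), kernelMajorant N (θ - φ) ^ q)
            * ((N ^ (q - 1))⁻¹ / q)) := by
          rw [intervalIntegral.integral_const_mul, intervalIntegral.integral_add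
            (Continuous.intervalIntegrable (by fun_prop) _ _)
            (Continuous.intervalIntegrable (by fun_prop) _ _), intervalIntegral.integral_div,
            intervalIntegral.integral_mul_const]
      _ ≤ N ^ (1 / p) * (2 * Real.pi / p +
          (4 * (2 ^ q * (3 * Real.pi) / (q - 1)) * N ^ (q - 1)) * ((N ^ (q - 1))⁻¹ / q)) := by
          gcongr
          exact integral_kernelMajorant_rpow_le hN hq1 φ
      _ = _ := by
          have : N ^ (q - 1) ≠ 0 := by positivity
          field_simp

lemma one_sub_conj_mul_ne_zero {l z : ℂ} (hl : ‖l‖ < 1) (hz : ‖z‖ ≤ 1) :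
    1 - (starRingEnd ℂ) l * z ≠ 0 := by
  intro h
  have h1 : ‖(starRingEnd ℂ) l * z‖ = 1 := by rw [← sub_eq_zero.mp h, norm_one]
  rw [norm_mul, RCLike.norm_conj] at h1
  nlinarith [norm_nonneg l, norm_nonneg z]

lemma one_sub_le_norm_one_sub_conj_mul {l z : ℂ} {r : ℝ} (hl : ‖l‖ ≤ r) (hz : ‖z‖ ≤ 1) :
    1 - r ≤ ‖1 - (starRingEnd ℂ) l * z‖ := by
  have h := norm_sub_norm_le (1:ℂ) ((starRingEnd ℂ) l * z)
  rw [norm_one, norm_mul, RCLike.norm_conj] at h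
  nlinarith [norm_nonneg l, norm_nonneg z]

lemma norm_sq_one_sub_conj_mul_sub_norm_sq_sub (l z : ℂ) :
    ‖1 - (starRingEnd ℂ) l * z‖ ^ 2 - ‖l - z‖ ^ 2 = (1 - ‖l‖ ^ 2) * (1 - ‖z‖ ^ 2) := by
  simp only [← Complex.normSq_eq_norm_sq, Complex.normSq_apply, Complex.sub_re, Complex.sub_im,
    Complex.mul_re, Complex.mul_im, Complex.conj_re, Complex.conj_im, Complex.one_re,
    Complex.one_im]
  ring

lemma norm_blaschkeF_sq {l z : ℂ} (hl : ‖l‖ < 1) (hz : ‖z‖ ≤ 1) :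
    ‖blaschkeF l z‖ ^ 2
      = 1 - (1 - ‖l‖ ^ 2) * (1 - ‖z‖ ^ 2) / ‖1 - (starRingEnd ℂ) l * z‖ ^ 2 := by
  have h0 : ‖1 - (starRingEnd ℂ) l * z‖ ≠ 0 := norm_ne_zero_iff.mpr (one_sub_conj_mul_ne_zero hl hz)
  rw [← norm_sq_one_sub_conj_mul_sub_norm_sq_sub, blaschkeF, norm_div, div_pow,
    sub_div, div_self (pow_ne_zero 2 h0)]
  ring

lemma norm_blaschkeF_le_one {l z : ℂ} (hl : ‖l‖ < 1) (hz : ‖z‖ ≤ 1) : ‖blaschkeF l z‖ ≤ 1 := by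
  refine (sq_le_one_iff₀ (norm_nonneg _)).mp ?_
  rw [norm_blaschkeF_sq hl hz]
  have h1 : 0 ≤ 1 - ‖l‖ ^ 2 := by nlinarith [norm_nonneg l]
  have h2 : 0 ≤ 1 - ‖z‖ ^ 2 := by nlinarith [norm_nonneg z]
  have : 0 ≤ (1 - ‖l‖ ^ 2) * (1 - ‖z‖ ^ 2) / ‖1 - (starRingEnd ℂ) l * z‖ ^ 2 := by positivity
  linarith

lemma le_norm_blaschkeF_sq {l z : ℂ} {r : ℝ} (hl : ‖l‖ ≤ r) (hr : r < 1) (hz : ‖z‖ ≤ 1) :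
    1 - (1 - ‖z‖ ^ 2) / (1 - r) ^ 2 ≤ ‖blaschkeF l z‖ ^ 2 := by
  rw [norm_blaschkeF_sq (hl.trans_lt hr) hz]
  have h1 : 0 < 1 - r := by linarith
  have h2 : 0 ≤ 1 - ‖z‖ ^ 2 := by nlinarith [norm_nonneg z]
  have h3 : (1 - ‖l‖ ^ 2) * (1 - ‖z‖ ^ 2) ≤ 1 - ‖z‖ ^ 2 := by nlinarith [sq_nonneg ‖l‖]
  have h4 := one_sub_le_norm_one_sub_conj_mul hl hz
  gcongr

lemma differentiableOn_inv_one_sub_conj_mul {l : ℂ} (hl : ‖l‖ < 1) :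
    DifferentiableOn ℂ (fun z => (1 - (starRingEnd ℂ) l * z)⁻¹) (ball 0 1) :=
  DifferentiableOn.inv (by fun_prop) fun _ hz =>
    one_sub_conj_mul_ne_zero hl (mem_ball_zero_iff.mp hz).le

lemma differentiableOn_blaschkeF {l : ℂ} (hl : ‖l‖ < 1) :
    DifferentiableOn ℂ (blaschkeF l) (ball 0 1) :=
  DifferentiableOn.mul (by fun_prop) (differentiableOn_inv_one_sub_conj_mul hl)

lemma blaschkeF_ne_zero {l z : ℂ} (hl : ‖l‖ < 1) (hz : ‖z‖ ≤ 1) (hlz : l ≠ z) :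
    blaschkeF l z ≠ 0 :=
  div_ne_zero (sub_ne_zero.mpr hlz) (one_sub_conj_mul_ne_zero hl hz)

lemma blaschkeF_sub_blaschkeF {l w z : ℂ} (hl : ‖l‖ < 1) (hw : ‖w‖ ≤ 1) (hz : ‖z‖ ≤ 1) :
    blaschkeF l w - blaschkeF l z = (w - z) * ((1 - (starRingEnd ℂ) l * z)⁻¹ *
      (((starRingEnd ℂ) l * l - 1) * (1 - (starRingEnd ℂ) l * w)⁻¹)) := by
  have h1 := one_sub_conj_mul_ne_zero hl hw
  have h2 := one_sub_conj_mul_ne_zero hl hz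
  unfold blaschkeF
  linear_combination (l - z) * (1 - (starRingEnd ℂ) l * z)⁻¹ * mul_inv_cancel₀ h1
    - (l - w) * (1 - (starRingEnd ℂ) l * w)⁻¹ * mul_inv_cancel₀ h2

lemma norm_conj_mul_self_sub_one_le {l : ℂ} {r : ℝ} (hl : ‖l‖ ≤ r) (hr : r < 1) {w z : ℂ}
    (hw : ‖w‖ ≤ 1) (hz : ‖z‖ ≤ 1) :
    ‖(1 - (starRingEnd ℂ) l * z)⁻¹ *
      (((starRingEnd ℂ) l * l - 1) * (1 - (starRingEnd ℂ) l * w)⁻¹)‖ ≤ 2 / (1 - r) := by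
  have hl1 : ‖l‖ < 1 := hl.trans_lt hr
  have hl0 := norm_nonneg l
  have h1 : ‖(starRingEnd ℂ) l * l - 1‖ = 1 - ‖l‖ ^ 2 := by
    rw [Complex.conj_mul', ← Complex.ofReal_pow, ← Complex.ofReal_one, ← Complex.ofReal_sub,
      Complex.norm_real, Real.norm_eq_abs, abs_of_nonpos (by nlinarith)]
    ring
  have h2 := one_sub_le_norm_one_sub_conj_mul le_rfl hw (l := l)
  have h3 := one_sub_le_norm_one_sub_conj_mul le_rfl hz (l := l)
  have h4 : 0 < 1 - ‖l‖ := by linarith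
  rw [norm_mul, norm_mul, norm_inv, norm_inv, h1]
  calc ‖1 - (starRingEnd ℂ) l * z‖⁻¹ * ((1 - ‖l‖ ^ 2) * ‖1 - (starRingEnd ℂ) l * w‖⁻¹)
      ≤ (1 - ‖l‖)⁻¹ * ((1 - ‖l‖ ^ 2) * (1 - ‖l‖)⁻¹) := by
        have : 0 ≤ 1 - ‖l‖ ^ 2 := by nlinarith
        gcongr
    _ = (1 + ‖l‖) / (1 - ‖l‖) := by field_simp; ring
    _ ≤ 2 / (1 - r) := by
        have : 0 < 1 - r := by linarith
        gcongr
        linarith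

lemma differentiableOn_prod_blaschkeF {n : ℕ} {σ : Fin n → ℂ} (hσ : ∀ i, ‖σ i‖ < 1) :
    DifferentiableOn ℂ (fun z => ∏ i, blaschkeF (σ i) z) (ball 0 1) :=
  DifferentiableOn.fun_finsetProd fun i _ => differentiableOn_blaschkeF (hσ i)

lemma norm_prod_blaschkeF_le_one {n : ℕ} {σ : Fin n → ℂ} (hσ : ∀ i, ‖σ i‖ < 1) {z : ℂ}
    (hz : ‖z‖ ≤ 1) : ‖∏ i, blaschkeF (σ i) z‖ ≤ 1 := by
  rw [norm_prod]
  exact Finset.prod_le_one (fun i _ => norm_nonneg _) fun i _ => norm_blaschkeF_le_one (hσ i) hz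

/-- The difference quotient of a Blaschke product of degree `n` is a sum of `n` products of a
function of `z` and a function of `w`. -/
lemma exists_prod_blaschkeF_sub_eq {r : ℝ} (hr : r < 1) (n : ℕ) (σ : Fin n → ℂ)
    (hσ : ∀ i, ‖σ i‖ ≤ r) :
    ∃ u v : Fin n → ℂ → ℂ, (∀ k, DifferentiableOn ℂ (u k) (ball 0 1)) ∧
      (∀ k, DifferentiableOn ℂ (v k) (ball 0 1)) ∧
      (∀ w ∈ ball (0:ℂ) 1, ∀ z ∈ ball (0:ℂ) 1,
        ∏ i, blaschkeF (σ i) w - ∏ i, blaschkeF (σ i) z = (w - z) * ∑ k, u k z * v k w) ∧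
      ∀ k, ∀ w ∈ ball (0:ℂ) 1, ∀ z ∈ ball (0:ℂ) 1, ‖u k z * v k w‖ ≤ 2 / (1 - r) := by
  induction n with
  | zero => exact ⟨fun _ _ => 0, fun _ _ => 0, by simp, by simp, by simp, by simp⟩
  | succ n ih =>
    obtain ⟨u, v, hu, hv, huv, hle⟩ := ih (fun i => σ i.castSucc) fun i => hσ _
    have hσ1 : ∀ i, ‖σ i‖ < 1 := fun i => (hσ i).trans_lt hr
    set l := σ (Fin.last n) with hl
    have hl1 : ‖l‖ < 1 := hσ1 _
    refine ⟨Fin.snoc (α := fun _ => ℂ → ℂ) u fun z => (∏ i : Fin n, blaschkeF (σ i.castSucc) z) *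
        (1 - (starRingEnd ℂ) l * z)⁻¹,
      Fin.snoc (α := fun _ => ℂ → ℂ) (fun k w => v k w * blaschkeF l w)
        fun w => ((starRingEnd ℂ) l * l - 1) * (1 - (starRingEnd ℂ) l * w)⁻¹, ?_, ?_, ?_, ?_⟩
    · intro k
      refine Fin.lastCases ?_ (fun k => ?_) k
      · simp only [Fin.snoc_last]
        exact (differentiableOn_prod_blaschkeF fun i => hσ1 _).mul
          (differentiableOn_inv_one_sub_conj_mul hl1)
      · simpa only [Fin.snoc_castSucc] using hu k
    · intro k
      refine Fin.lastCases ?_ (fun k => ?_) k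
      · simp only [Fin.snoc_last]
        exact (differentiableOn_inv_one_sub_conj_mul hl1).const_mul _
      · simp only [Fin.snoc_castSucc]
        exact (hv k).mul (differentiableOn_blaschkeF hl1)
    · intro w hw z hz
      have hb := blaschkeF_sub_blaschkeF hl1 (mem_ball_zero_iff.mp hw).le
        (mem_ball_zero_iff.mp hz).le
      have hB := huv w hw z hz
      rw [Fin.prod_univ_castSucc, Fin.prod_univ_castSucc, Fin.sum_univ_castSucc]
      simp only [Fin.snoc_last, Fin.snoc_castSucc, ← hl]
      have hsum : ∑ k, u k z * (v k w * blaschkeF l w)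
          = (∑ k, u k z * v k w) * blaschkeF l w := by
        rw [Finset.sum_mul]
        exact Finset.sum_congr rfl fun k _ => by ring
      rw [hsum]
      linear_combination (blaschkeF l w) * hB + (∏ i : Fin n, blaschkeF (σ i.castSucc) z) * hb
    · intro k w hw z hz
      rw [mem_ball_zero_iff] at hw hz
      refine Fin.lastCases ?_ (fun k => ?_) k
      · simp only [Fin.snoc_last]
        rw [mul_assoc, norm_mul]
        exact (mul_le_of_le_one_left (norm_nonneg _)
          (norm_prod_blaschkeF_le_one (fun i => hσ1 _) hz.le)).trans
          (norm_conj_mul_self_sub_one_le (hσ _) hr hw.le hz.le)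
      · simp only [Fin.snoc_castSucc]
        rw [← mul_assoc, norm_mul]
        exact (mul_le_of_le_one_right (norm_nonneg _) (norm_blaschkeF_le_one hl1 hw.le)).trans
          (hle k w (by simpa using hw) z (by simpa using hz))

lemma exists_radius_half_le_norm_prod_blaschkeF {r : ℝ} (hr : r < 1) {n : ℕ} {σ : Fin n → ℂ}
    (hσ : ∀ i, ‖σ i‖ ≤ r) :
    ∃ ρ : ℝ, r < ρ ∧ 1 / 2 ≤ ρ ∧ ρ < 1 ∧
      ∀ w : ℂ, ‖w‖ = ρ → 1 / 2 ≤ ‖∏ i, blaschkeF (σ i) w‖ := by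
  have hr' : 1 - r ≠ 0 := by linarith
  have h1 : Filter.Tendsto (fun ρ : ℝ => 1 - (1 - ρ ^ 2) / (1 - r) ^ 2)
      (nhdsWithin 1 (Set.Iio 1)) (nhds 1) := by
    have : Continuous fun ρ : ℝ => 1 - (1 - ρ ^ 2) / (1 - r) ^ 2 := by fun_prop
    simpa using (this.tendsto 1).mono_left nhdsWithin_le_nhds
  have h0 : Filter.Tendsto (fun ρ : ℝ => ρ) (nhdsWithin 1 (Set.Iio 1)) (nhds 1) :=
    nhdsWithin_le_nhds
  have h2 := h1.pow n
  rw [one_pow] at h2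
  obtain ⟨ρ, hρ1, hρ2, hρ3, hρ4, hρ5⟩ := ((h1.eventually (lt_mem_nhds one_pos)).and
    ((h2.eventually (lt_mem_nhds (show (1 / 4 : ℝ) < 1 by norm_num))).and
    ((h0.eventually (lt_mem_nhds hr)).and
    ((h0.eventually (lt_mem_nhds (show (1 / 2 : ℝ) < 1 by norm_num))).and
      self_mem_nhdsWithin)))).exists
  refine ⟨ρ, hρ3, hρ4.le, hρ5, fun w hw => ?_⟩
  have hw1 : ‖w‖ ≤ 1 := hw.trans_le (le_of_lt hρ5)
  have h3 : (1 / 4 : ℝ) ≤ ‖∏ i, blaschkeF (σ i) w‖ ^ 2 := by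
    calc (1 / 4 : ℝ) ≤ ∏ _i : Fin n, (1 - (1 - ρ ^ 2) / (1 - r) ^ 2) := by
          simpa using hρ2.le
      _ ≤ ∏ i, ‖blaschkeF (σ i) w‖ ^ 2 := by
          refine Finset.prod_le_prod (fun _ _ => hρ1.le) fun i _ => ?_
          rw [← hw]
          exact le_norm_blaschkeF_sq (hσ i) hr hw1
      _ = _ := by rw [norm_prod, Finset.prod_pow]
  nlinarith [norm_nonneg (∏ i, blaschkeF (σ i) w)]

lemma mul_abs_sin_le_norm_circleMap_sub {ρ : ℝ} (hρ : 0 ≤ ρ) (θ : ℝ) (z : ℂ) :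
    ρ * |Real.sin (θ - Complex.arg z)| ≤ ‖circleMap 0 ρ θ - z‖ := by
  have h1 : circleMap 0 ρ θ - z = Complex.exp (Complex.arg z * Complex.I) *
      (ρ * Complex.exp ((θ - Complex.arg z : ℝ) * Complex.I) - ‖z‖) := by
    have h2 : Complex.exp (θ * Complex.I) = Complex.exp (Complex.arg z * Complex.I) *
        Complex.exp ((θ - Complex.arg z : ℝ) * Complex.I) := by
      rw [← Complex.exp_add]
      congr 1
      push_cast
      ring
    rw [circleMap_zero, h2]
    linear_combination Complex.norm_mul_exp_arg_mul_I z
  have h3 : (ρ * Complex.exp ((θ - Complex.arg z : ℝ) * Complex.I) - ‖z‖ : ℂ).im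
      = ρ * Real.sin (θ - Complex.arg z) := by
    rw [Complex.sub_im, Complex.im_ofReal_mul,
      Complex.exp_ofReal_mul_I_im, Complex.ofReal_im, sub_zero]
  rw [h1, norm_mul, Complex.norm_exp_ofReal_mul_I, one_mul]
  calc ρ * |Real.sin (θ - Complex.arg z)| = |ρ * Real.sin (θ - Complex.arg z)| := by
        rw [abs_mul, abs_of_nonneg hρ]
    _ ≤ _ := by rw [← h3]; exact Complex.abs_im_le_norm _

/-- A quotient `F / B` that is holomorphic near the zeros of `B` is holomorphic. -/
lemma exists_differentiableOn_eq_mul {F B h₀ : ℂ → ℂ} {ρ : ℝ}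
    (hF : DifferentiableOn ℂ F (ball 0 1)) (hB : DifferentiableOn ℂ B (ball 0 1))
    (hB0 : ∀ z ∈ ball (0:ℂ) 1, ρ ≤ ‖z‖ → B z ≠ 0)
    (hh₀ : DifferentiableOn ℂ h₀ (ball 0 ρ)) (hFB : ∀ z ∈ ball (0:ℂ) 1, ‖z‖ < ρ → F z = B z * h₀ z) :
    ∃ h : ℂ → ℂ, DifferentiableOn ℂ h (ball 0 1) ∧ ∀ z ∈ ball (0:ℂ) 1, F z = B z * h z := by
  classical
  set h : ℂ → ℂ := fun z => if ‖z‖ < ρ then h₀ z else F z / B z with hh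
  have hFh : ∀ z ∈ ball (0:ℂ) 1, F z = B z * h z := by
    intro z hz
    by_cases hzρ : ‖z‖ < ρ
    · simp only [hh, if_pos hzρ, hFB z hz hzρ]
    · simp only [hh, if_neg hzρ]
      rw [mul_div_cancel₀ _ (hB0 z hz (not_lt.mp hzρ))]
  refine ⟨h, fun z hz => DifferentiableAt.differentiableWithinAt ?_, hFh⟩
  have hz1 := isOpen_ball.mem_nhds hz
  by_cases hzρ : ‖z‖ < ρ
  · have hz2 : ball (0:ℂ) ρ ∈ nhds z := isOpen_ball.mem_nhds (by simpa using hzρ)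
    refine (hh₀.differentiableAt hz2).congr_of_eventuallyEq ?_
    filter_upwards [hz2] with y hy
    simp only [hh, if_pos (mem_ball_zero_iff.mp hy)]
  · have hBz := hB0 z hz (not_lt.mp hzρ)
    have hBd := hB.differentiableAt hz1
    refine ((hF.differentiableAt hz1).div hBd hBz).congr_of_eventuallyEq ?_
    filter_upwards [hz1, hBd.continuousAt.eventually_ne hBz] with y hy hy0
    rw [Pi.div_apply, hFh y hy, mul_div_cancel_left₀ _ hy0]

lemma norm_two_pi_I_inv_smul_circleIntegral_le {G : ℂ → ℂ} {ρ : ℝ} (hρ0 : 0 ≤ ρ) (hρ1 : ρ ≤ 1)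
    {H : ℝ → ℝ} (hH : Continuous H) (hGH : ∀ θ, ‖G (circleMap 0 ρ θ)‖ ≤ H θ) :
    ‖(2 * Real.pi * Complex.I : ℂ)⁻¹ • circleIntegral G 0 ρ‖
      ≤ (2 * Real.pi)⁻¹ * ∫ θ in (0:ℝ)..(2 * Real.pi), H θ := by
  have hpi := Real.pi_pos
  have h1 : ‖(2 * Real.pi * Complex.I : ℂ)⁻¹‖ = (2 * Real.pi)⁻¹ := by
    simp [abs_of_pos hpi]
  rw [norm_smul, h1]
  refine mul_le_mul_of_nonneg_left ?_ (by positivity)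
  refine intervalIntegral.norm_integral_le_of_norm_le (by positivity)
    (Filter.Eventually.of_forall fun θ _ => ?_) (hH.intervalIntegrable _ _)
  rw [norm_smul, deriv_circleMap, norm_mul, Complex.norm_I, norm_circleMap_zero, mul_one,
    abs_of_nonneg hρ0]
  exact (mul_le_of_le_one_left (norm_nonneg _) hρ1).trans (hGH θ)

/-- Upper bound in Theorem 2.1, Hardy case: there is `C_p > 0` such that any
`f ∈ Hol(D)` with `‖f‖_{H^p} ≤ 1` and `‖f‖_{H^∞} < ∞` admits an `H^∞`
interpolant `g` on any `n`-tuple `σ ⊂ D` with `max |λ_i| ≤ r`, with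
`‖g‖_{H^∞} ≤ C_p (n/(1-r))^{1/p}`. -/
theorem hardy_interpolation_upper_bound (p : ℝ) (hp : 1 ≤ p) :
    ∃ C : ℝ, 0 < C ∧
      ∀ (n : ℕ), 1 ≤ n → ∀ r : ℝ, 0 ≤ r → r < 1 →
      ∀ σ : Fin n → ℂ, (∀ i, ‖σ i‖ ≤ r) →
      ∀ f : ℂ → ℂ, DifferentiableOn ℂ f (ball (0:ℂ) 1) →
      -- `‖f‖_{H^p} ≤ 1`
      (∀ ρ : ℝ, 0 < ρ → ρ < 1 →
        ((2 * Real.pi)⁻¹ * ∫ θ in (0:ℝ)..(2 * Real.pi),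
          ‖f ((ρ : ℂ) * Complex.exp ((θ : ℂ) * Complex.I))‖ ^ p) ≤ 1) →
      -- `‖f‖_{H^∞} < ∞`
      (∃ M : ℝ, ∀ z ∈ ball (0:ℂ) 1, ‖f z‖ ≤ M) →
      ∃ g : ℂ → ℂ, DifferentiableOn ℂ g (ball (0:ℂ) 1) ∧
        -- `g` interpolates `f` on `σ` (with multiplicities)
        (∃ h : ℂ → ℂ, DifferentiableOn ℂ h (ball (0:ℂ) 1) ∧
          ∀ z ∈ ball (0:ℂ) 1, f z - g z = (∏ i, blaschkeF (σ i) z) * h z) ∧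
        -- `‖g‖_{H^∞} ≤ C_p (n/(1-r))^{1/p}`
        ∀ z ∈ ball (0:ℂ) 1, ‖g z‖ ≤ C * ((n : ℝ) / (1 - r)) ^ (1 / p) := by
  have hpi := Real.pi_pos
  obtain ⟨C, hC, hint⟩ := exists_integral_mul_kernelMajorant_le hp
  refine ⟨(2 * Real.pi)⁻¹ * (C * 4 ^ (1 / p)), by positivity,
    fun n hn r hr0 hr1 σ hσ f hf hfp _ => ?_⟩
  have hr1' : 0 < 1 - r := by linarith
  have hσ1 : ∀ i, ‖σ i‖ < 1 := fun i => (hσ i).trans_lt hr1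
  obtain ⟨ρ, hρr, hρ2, hρ1, hBρ⟩ := exists_radius_half_le_norm_prod_blaschkeF hr1 hσ
  obtain ⟨u, v, hu, hv, huv, huv_le⟩ := exists_prod_blaschkeF_sub_eq hr1 n σ hσ
  have hρ0 : 0 < ρ := by linarith
  set B : ℂ → ℂ := fun z => ∏ i, blaschkeF (σ i) z with hBdef
  have hBd : DifferentiableOn ℂ B (ball 0 1) := differentiableOn_prod_blaschkeF hσ1
  have hsphere : sphere (0:ℂ) ρ ⊆ ball 0 1 := fun w hw => by
    rw [mem_ball_zero_iff, mem_sphere_zero_iff_norm.mp hw]; exact hρ1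
  have hBs : ∀ w ∈ sphere (0:ℂ) ρ, B w ≠ 0 := fun w hw h => by
    have := hBρ w (mem_sphere_zero_iff_norm.mp hw)
    simp only [hBdef] at h
    rw [h, norm_zero] at this
    linarith
  have hfs : ContinuousOn f (sphere 0 ρ) := hf.continuousOn.mono hsphere
  have hfB : ContinuousOn (fun w => f w / B w) (sphere 0 ρ) :=
    hfs.div (hBd.continuousOn.mono hsphere) hBs
  have hfBv : ∀ k, ContinuousOn (fun w => f w / B w * v k w) (sphere 0 ρ) := fun k =>
    hfB.mul ((hv k).continuousOn.mono hsphere)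
  set c : Fin n → ℂ := fun k =>
    (2 * Real.pi * Complex.I : ℂ)⁻¹ • circleIntegral (fun w => f w / B w * v k w) 0 ρ with hc
  have hg : ∀ z, ∑ k, u k z * c k = (2 * Real.pi * Complex.I : ℂ)⁻¹ •
      circleIntegral (fun w => ∑ k, u k z * (f w / B w * v k w)) 0 ρ := by
    intro z
    rw [circleIntegral.integral_fun_sum, Finset.smul_sum]
    · refine Finset.sum_congr rfl fun k _ => ?_
      rw [circleIntegral.integral_const_mul]
      simp only [hc, smul_eq_mul]
      ring
    · exact fun k _ => (continuousOn_const.mul (hfBv k)).circleIntegrable hρ0.le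
  refine ⟨fun z => ∑ k, u k z * c k,
    DifferentiableOn.fun_sum fun k _ => (hu k).mul_const _, ?_, ?_⟩
  · refine exists_differentiableOn_eq_mul (ρ := ρ) (F := fun z => f z - ∑ k, u k z * c k)
      (h₀ := fun z => (2 * Real.pi * Complex.I : ℂ)⁻¹ •
        circleIntegral (fun w => (w - z)⁻¹ • (f w / B w)) 0 ρ)
      (hf.sub (DifferentiableOn.fun_sum fun k _ => (hu k).mul_const _)) hBd ?_ ?_ ?_
    · intro z hz hzρ
      refine Finset.prod_ne_zero_iff.mpr fun i _ =>
        blaschkeF_ne_zero (hσ1 i) (mem_ball_zero_iff.mp hz).le fun h => ?_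
      have := hσ i
      rw [h] at this
      linarith
    · obtain ⟨R, hR⟩ : ∃ R : NNReal, (R : ℝ) = ρ := ⟨⟨ρ, hρ0.le⟩, rfl⟩
      have hci := hfB.circleIntegrable hρ0.le
      rw [← hR] at hci hρ0 ⊢
      rw [← Metric.eball_coe]
      exact (hasFPowerSeriesOn_cauchy_integral hci hρ0).differentiableOn
    · intro z hz hzρ
      have hzb : z ∈ ball (0:ℂ) ρ := mem_ball_zero_iff.mpr hzρ
      have hne : ∀ w ∈ sphere (0:ℂ) ρ, w - z ≠ 0 := fun w hw h => by
        rw [sub_eq_zero.mp h, mem_sphere_zero_iff_norm] at hw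
        linarith
      have hcauchy : DiffContOnCl ℂ f (ball 0 ρ) := (hf.mono fun w hw => by
        rw [closure_ball _ hρ0.ne', mem_closedBall_zero_iff] at hw
        exact mem_ball_zero_iff.mpr (hw.trans_lt hρ1)).diffContOnCl
      have hinv : ContinuousOn (fun w : ℂ => (w - z)⁻¹) (sphere 0 ρ) :=
        ContinuousOn.inv₀ (by fun_prop) hne
      have hint1 : CircleIntegrable (fun w => (w - z)⁻¹ • f w) 0 ρ :=
        (hinv.smul hfs).circleIntegrable hρ0.le
      have hint2 : CircleIntegrable (fun w => ∑ k, u k z * (f w / B w * v k w)) 0 ρ :=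
        (continuousOn_finsetSum _ fun k _ =>
          continuousOn_const.mul (hfBv k)).circleIntegrable hρ0.le
      rw [hg z, ← hcauchy.two_pi_i_inv_smul_circleIntegral_sub_inv_smul hzb, ← smul_sub,
        ← circleIntegral.integral_sub hint1 hint2,
        mul_smul_comm, ← circleIntegral.integral_const_mul]
      congr 1
      refine circleIntegral.integral_congr hρ0.le fun w hw => ?_
      have hsum : ∑ k, u k z * (f w / B w * v k w) = f w / B w * ∑ k, u k z * v k w := by
        rw [Finset.mul_sum]
        exact Finset.sum_congr rfl fun k _ => by ring
      have hBB := huv w (hsphere hw) z hz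
      change B w - B z = _ at hBB
      have hw1 := hne w hw
      have hw2 := hBs w hw
      simp only [hsum, smul_eq_mul]
      field_simp
      linear_combination f w * hBB
  · intro z hz
    set N : ℝ := 4 * ((n : ℝ) / (1 - r)) with hN
    have hnr : 0 < (n : ℝ) / (1 - r) := div_pos (by exact_mod_cast hn) hr1'
    have hN0 : 0 < N := by positivity
    have hz1 : ‖z‖ ≤ 1 := (mem_ball_zero_iff.mp hz).le
    have hmem : ∀ θ, circleMap 0 ρ θ ∈ sphere (0:ℂ) ρ := fun θ =>
      circleMap_mem_sphere _ hρ0.le θ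
    have hfc : Continuous fun θ => ‖f (circleMap 0 ρ θ)‖ :=
      (hfs.comp_continuous (continuous_circleMap 0 ρ) hmem).norm
    have hbound : ∀ θ, ‖∑ k, u k z * (f (circleMap 0 ρ θ) / B (circleMap 0 ρ θ) *
        v k (circleMap 0 ρ θ))‖
          ≤ ‖f (circleMap 0 ρ θ)‖ * kernelMajorant N (θ - Complex.arg z) := by
      intro θ
      set w := circleMap 0 ρ θ with hw
      have hwb := hsphere (hmem θ)
      have hB2 : 1 / 2 ≤ ‖B w‖ := hBρ w (mem_sphere_zero_iff_norm.mp (hmem θ))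
      have hsum : ∑ k, u k z * (f w / B w * v k w) = f w * ((∑ k, u k z * v k w) / B w) := by
        rw [Finset.sum_div, Finset.mul_sum]
        exact Finset.sum_congr rfl fun k _ => by ring
      rw [hsum, norm_mul]
      refine mul_le_mul_of_nonneg_left (le_kernelMajorant hN0.le ?_ ?_) (norm_nonneg _)
      · rw [norm_div, div_le_iff₀ (by linarith)]
        calc ‖∑ k, u k z * v k w‖ ≤ ∑ _k : Fin n, 2 / (1 - r) :=
              norm_sum_le_of_le _ fun k _ => huv_le k w hwb z hz
          _ = N * (1 / 2) := by
              rw [Finset.sum_const, Finset.card_univ, Fintype.card_fin, nsmul_eq_mul, hN]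
              ring
          _ ≤ N * ‖B w‖ := by gcongr
      · have h1 : ‖w - z‖ * ‖∑ k, u k z * v k w‖ ≤ ‖B w‖ + 1 := by
          rw [← norm_mul, ← huv w hwb z hz]
          exact (norm_sub_le _ _).trans (add_le_add_right (norm_prod_blaschkeF_le_one hσ1 hz1) _)
        have h2 := mul_abs_sin_le_norm_circleMap_sub hρ0.le θ z
        rw [← hw] at h2
        have h3 : |Real.sin (θ - Complex.arg z)| ≤ 2 * ‖w - z‖ := by
          nlinarith [abs_nonneg (Real.sin (θ - Complex.arg z))]
        rw [norm_div, div_mul_eq_mul_div, div_le_iff₀ (by linarith)]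
        nlinarith [mul_le_mul_of_nonneg_left h3 (norm_nonneg (∑ k, u k z * v k w))]
    have hP := continuous_kernelMajorant hN0.le
    have h1 := norm_two_pi_I_inv_smul_circleIntegral_le hρ0.le hρ1.le
      (G := fun w => ∑ k, u k z * (f w / B w * v k w))
      (H := fun θ => ‖f (circleMap 0 ρ θ)‖ * kernelMajorant N (θ - Complex.arg z))
      (by fun_prop) hbound
    have h2 := hint N hN0 (Complex.arg z) (fun θ => ‖f (circleMap 0 ρ θ)‖) hfc
      (fun θ => norm_nonneg _) (by simpa only [circleMap_zero] using hfp ρ hρ0 hρ1)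
    simp only [hg z]
    refine h1.trans ?_
    calc (2 * Real.pi)⁻¹ * ∫ θ in (0:ℝ)..(2 * Real.pi),
          ‖f (circleMap 0 ρ θ)‖ * kernelMajorant N (θ - Complex.arg z)
        ≤ (2 * Real.pi)⁻¹ * (C * N ^ (1 / p)) := by gcongr
      _ = _ := by
          rw [hN, Real.mul_rpow (by norm_num) hnr.le]
          ring
end
end

section
/- For every p ∈ [1, ∞) there exists a constant c_p > 0 (depending only on p) such that: for every n ≥ 1 and every λ ∈ D, there exists f ∈ Hol(D) with ‖f‖_{H^p} ≤ 1 and ‖f‖_{H^∞} < ∞ such that every g ∈ H^∞ satisfying f − g = b_λ^n · h for some h ∈ Hol(D) must satisfy ‖g‖_{H^∞} ≥ c_p · (n/(1−|λ|))^{1/p}. (Lower bound in Theorem 2.1, Hardy case, via one-point interpolation sequences.) -/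
open Complex Metric

noncomputable section

open Polynomial in
theorem circleAverage_eval_mul_zpow_neg (Q : ℂ[X]) (m : ℕ) :
    Real.circleAverage (fun z : ℂ ↦ Q.eval z * z ^ (-(m : ℤ))) 0 1 = Q.coeff m := by
  have hz (k : ℤ) : ContinuousOn (fun z : ℂ ↦ z ^ k) (sphere (0 : ℂ) 1) := fun z hz ↦
    (continuousAt_zpow₀ z k (Or.inl (ne_of_mem_sphere hz one_ne_zero))).continuousWithinAt
  have hpow (k : ℕ) : Real.circleAverage (fun z : ℂ ↦ z ^ k) 0 1 = if k = 0 then 1 else 0 := by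
    rw [((differentiable_id.pow k).diffContOnCl).circleAverage (f := fun z : ℂ ↦ z ^ k)]
    simp [zero_pow_eq]
  induction Q using Polynomial.induction_on' with
  | add p q hp hq =>
    simp only [eval_add, add_mul, coeff_add]
    rw [Real.circleAverage_fun_add, hp, hq]
    · exact ((p.continuous.continuousOn).mul (hz _)).circleIntegrable zero_le_one
    · exact ((q.continuous.continuousOn).mul (hz _)).circleIntegrable zero_le_one
  | monomial i a =>
    have key : Real.circleAverage (fun z : ℂ ↦ z ^ ((i : ℤ) - m)) 0 1 = if i = m then 1 else 0 := by
      rcases le_total m i with h | h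
      · obtain ⟨k, rfl⟩ := Nat.exists_eq_add_of_le h
        have := hpow k
        simpa using this
      · obtain ⟨k, rfl⟩ := Nat.exists_eq_add_of_le h
        have := hpow k
        rw [← Real.circleAverage_zero_one_congr_inv] at this
        simpa [zpow_neg, eq_comm] using this
    rw [coeff_monomial]
    have : Real.circleAverage (fun z : ℂ ↦ (monomial i a).eval z * z ^ (-(m : ℤ))) 0 1
        = Real.circleAverage (fun z : ℂ ↦ a • z ^ ((i : ℤ) - m)) 0 1 := by
      refine Real.circleAverage_congr_sphere fun z hz ↦ ?_
      have hz0 : z ≠ 0 := ne_of_mem_sphere hz (by simp)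
      simp only [eval_monomial, smul_eq_mul, zpow_sub₀ hz0, zpow_natCast, zpow_neg]
      ring
    rw [this, Real.circleAverage_fun_smul, key]
    simp

theorem norm_circleAverage_le {W : ℂ → ℂ} {B : ℂ → ℝ} (hW : ContinuousOn W (sphere 0 1))
    (hB : ContinuousOn B (sphere 0 1)) (h : ∀ z ∈ sphere (0 : ℂ) 1, ‖W z‖ ≤ B z) :
    ‖Real.circleAverage W 0 1‖ ≤ Real.circleAverage B 0 1 := by
  calc ‖Real.circleAverage W 0 1‖ ≤ Real.circleAverage (fun z ↦ ‖W z‖) 0 1 := by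
        simp only [Real.circleAverage, norm_smul, smul_eq_mul]
        rw [Real.norm_of_nonneg (by positivity)]
        gcongr
        exact intervalIntegral.norm_integral_le_integral_norm (by positivity)
    _ ≤ _ := by
        refine Real.circleAverage_mono (hW.norm.circleIntegrable zero_le_one)
          (hB.circleIntegrable zero_le_one) ?_
        simpa using h

open Polynomial in
theorem norm_eval_sq_mul_zpow (D : ℂ[X]) (m : ℤ) {z : ℂ} (hz : ‖z‖ = 1) :
    ‖D.eval z ^ 2 * z ^ m‖ = ‖D.eval z‖ ^ 2 := by
  simp [hz]

open Polynomial in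
theorem circleAverage_norm_sum_X_pow_sq (n : ℕ) :
    Real.circleAverage (fun z ↦ ‖(∑ k ∈ Finset.range n, (X : ℂ[X]) ^ k).eval z‖ ^ 2) 0 1 = n := by
  rw [← sum_sq_norm_coeff_eq_circleAverage]
  have hc (i : ℕ) : (∑ k ∈ Finset.range n, (X : ℂ[X]) ^ k).coeff i = if i < n then 1 else 0 := by
    simp [finsetSum_coeff, coeff_X_pow]
  have hs : (∑ k ∈ Finset.range n, (X : ℂ[X]) ^ k).support = Finset.range n := by
    ext i; simp [mem_support_iff, hc]
  rw [hs, Finset.sum_congr rfl (g := fun _ ↦ (1 : ℝ))]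
  · simp
  · intro i hi
    simp [hc, Finset.mem_range.1 hi]

open Polynomial in
/-- A Fejér-type estimate: the kernel `|1 + z + ⋯ + z ^ (n - 1)| ^ 2` tests the first `n`
Taylor coefficients of a bounded function. -/
theorem norm_coeff_mul_sq_le {n : ℕ} (hn : 1 ≤ n) (P : ℂ[X]) {u H : ℂ → ℂ} {M : ℝ}
    (hH : DiffContOnCl ℂ H (ball 0 1))
    (hu : ∀ z ∈ sphere (0 : ℂ) 1, u z = P.eval z + z ^ n * H z)
    (hM : ∀ z ∈ sphere (0 : ℂ) 1, ‖u z‖ ≤ M) :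
    ‖(P * (∑ k ∈ Finset.range n, (X : ℂ[X]) ^ k) ^ 2).coeff (n - 1)‖ ≤ n * M := by
  set D := ∑ k ∈ Finset.range n, (X : ℂ[X]) ^ k with hD
  set W : ℂ → ℂ := fun z ↦ (P * D ^ 2).eval z * z ^ (-((n - 1 : ℕ) : ℤ)) with hWdef
  set V : ℂ → ℂ := fun z ↦ z * (D.eval z ^ 2 * H z) with hV
  have hWc : ContinuousOn W (sphere 0 1) := by
    refine (Polynomial.continuous _).continuousOn.mul fun z hz ↦ ?_
    exact (continuousAt_zpow₀ z _
      (Or.inl (ne_of_mem_sphere hz one_ne_zero))).continuousWithinAt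
  have hVd : DiffContOnCl ℂ V (ball 0 1) := by
    have hD2 : DiffContOnCl ℂ (fun z ↦ D.eval z ^ 2) (ball 0 1) :=
      ((Polynomial.differentiable D).pow 2).diffContOnCl
    exact differentiable_id.diffContOnCl.smul (hD2.smul hH)
  have hVc : ContinuousOn V (sphere 0 1) :=
    hVd.continuousOn_ball.mono sphere_subset_closedBall
  have hV0 : Real.circleAverage V 0 1 = 0 := by
    rw [DiffContOnCl.circleAverage (by simpa using hVd)]
    simp [hV]
  have havg : Real.circleAverage (W + V) 0 1 = (P * D ^ 2).coeff (n - 1) := by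
    rw [Real.circleAverage_add (hWc.circleIntegrable zero_le_one)
      (hVc.circleIntegrable zero_le_one), hV0, add_zero, circleAverage_eval_mul_zpow_neg]
  rw [← havg]
  have hbound : ∀ z ∈ sphere (0 : ℂ) 1, ‖(W + V) z‖ ≤ M * ‖D.eval z‖ ^ 2 := by
    intro z hz
    have hz0 : z ≠ 0 := ne_of_mem_sphere hz one_ne_zero
    have hz1 : ‖z‖ = 1 := by simpa using hz
    have : (W + V) z = u z * (D.eval z ^ 2 * z ^ (-((n - 1 : ℕ) : ℤ))) := by
      obtain ⟨m, rfl⟩ := Nat.exists_eq_add_of_le' hn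
      simp only [Pi.add_apply, hWdef, hV, hu z hz, eval_mul, eval_pow, zpow_neg,
        Nat.add_sub_cancel, zpow_natCast]
      field_simp
      ring
    rw [this, norm_mul, norm_eval_sq_mul_zpow _ _ hz1]
    exact mul_le_mul_of_nonneg_right (hM z hz) (by positivity)
  refine (norm_circleAverage_le (hWc.add hVc) (by fun_prop) hbound).trans_eq ?_
  have := Real.circleAverage_fun_smul (a := M) (f := fun z : ℂ ↦ ‖D.eval z‖ ^ 2) (c := 0) (R := 1)
  simp only [smul_eq_mul] at this
  rw [this, hD, circleAverage_norm_sum_X_pow_sq, mul_comm]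

theorem sum_antidiagonal_succ_mul_succ (m : ℕ) :
    ∑ x ∈ Finset.HasAntidiagonal.antidiagonal m, ((x.1 : ℝ) + 1) * (x.2 + 1) = (m + 1) * (m + 2) * (m + 3) / 6 := by
  induction m with
  | zero => norm_num
  | succ m ih =>
    rw [Finset.Nat.sum_antidiagonal_succ']
    have h1 : ∑ x ∈ Finset.HasAntidiagonal.antidiagonal m, ((x.1 : ℝ) + 1) = (m + 1) * (m + 2) / 2 := by
      rw [Finset.Nat.sum_antidiagonal_eq_sum_range_succ (fun i _ ↦ (i : ℝ) + 1)]
      clear ih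
      induction m with
      | zero => norm_num
      | succ k ih => rw [Finset.sum_range_succ, ih]; push_cast; ring
    have h2 : ∀ x ∈ Finset.HasAntidiagonal.antidiagonal m,
        ((x.1 : ℝ) + 1) * ((x.2 + 1 : ℕ) + 1) =
          ((x.1 : ℝ) + 1) * (x.2 + 1) + ((x.1 : ℝ) + 1) := by
      intro x _; push_cast; ring
    rw [Finset.sum_congr rfl h2, Finset.sum_add_distrib, ih, h1]
    push_cast
    ring

open Polynomial in
theorem Polynomial.coeff_mul_nonneg {p q : ℝ[X]} (hp : ∀ i, 0 ≤ p.coeff i)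
    (hq : ∀ i, 0 ≤ q.coeff i) (i : ℕ) : 0 ≤ (p * q).coeff i := by
  rw [coeff_mul]
  exact Finset.sum_nonneg fun x _ ↦ mul_nonneg (hp _) (hq _)

open Polynomial in
theorem le_coeff_mul_sq {n : ℕ} (hn : 1 ≤ n) {r s : ℝ} (hr : 0 ≤ r) (hs0 : 0 ≤ s)
    (hs : ∀ k < n, 1 / 4 ≤ s ^ k) :
    (n : ℝ) ^ 3 / 24 ≤ (((1 + C r * X) ^ 2 *
      ∑ k ∈ Finset.range n, C (((k : ℝ) + 1) * s ^ k) * X ^ k) *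
        (∑ k ∈ Finset.range n, (X : ℝ[X]) ^ k) ^ 2).coeff (n - 1) := by
  obtain ⟨m, rfl⟩ := Nat.exists_eq_add_of_le' hn
  set D := ∑ k ∈ Finset.range (m + 1), (X : ℝ[X]) ^ k with hD
  set T := ∑ k ∈ Finset.range (m + 1), C (((k : ℝ) + 1) * s ^ k) * X ^ k with hT
  have hDc (i : ℕ) : D.coeff i = if i < m + 1 then 1 else 0 := by
    simp [hD, finsetSum_coeff, coeff_X_pow]
  have hTc (i : ℕ) : T.coeff i = if i < m + 1 then ((i : ℝ) + 1) * s ^ i else 0 := by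
    simp [hT, finsetSum_coeff, coeff_X_pow, -map_mul, -map_add]
  have hD0 (i : ℕ) : 0 ≤ D.coeff i := by rw [hDc]; split_ifs <;> norm_num
  have hT0 (i : ℕ) : 0 ≤ T.coeff i := by rw [hTc]; split_ifs <;> positivity
  have hZ0 : ∀ i, 0 ≤ (T * D ^ 2).coeff i := by
    rw [sq]; exact coeff_mul_nonneg hT0 (coeff_mul_nonneg hD0 hD0)
  have hR0 (i : ℕ) : 0 ≤ (C (2 * r) * X + C (r ^ 2) * X ^ 2 : ℝ[X]).coeff i := by
    rw [coeff_add, coeff_C_mul, coeff_C_mul, coeff_X, coeff_X_pow]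
    split_ifs <;> simp <;> positivity
  have hsplit : ((1 + C r * X) ^ 2 * T) * D ^ 2
      = T * D ^ 2 + (C (2 * r) * X + C (r ^ 2) * X ^ 2) * (T * D ^ 2) := by
    simp only [map_mul, map_pow, map_ofNat]; ring
  have hD2 (j : ℕ) (hj : j ≤ m) : (D ^ 2).coeff j = j + 1 := by
    rw [sq, coeff_mul, Finset.sum_congr rfl (g := fun _ ↦ (1 : ℝ))]
    · simp
    · intro x hx
      have := Finset.HasAntidiagonal.mem_antidiagonal.1 hx
      rw [hDc, hDc, if_pos (by omega), if_pos (by omega), one_mul]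
  rw [hsplit, coeff_add, Nat.add_sub_cancel]
  refine le_trans ?_ (le_add_of_nonneg_right (coeff_mul_nonneg hR0 hZ0 _))
  rw [coeff_mul]
  calc ((m + 1 : ℕ) : ℝ) ^ 3 / 24 ≤ 1 / 4 * ((m + 1) * (m + 2) * (m + 3) / 6) := by
        push_cast; nlinarith [(Nat.cast_nonneg m : (0 : ℝ) ≤ m), sq_nonneg (m : ℝ)]
    _ = ∑ x ∈ Finset.HasAntidiagonal.antidiagonal m, 1 / 4 * (((x.1 : ℝ) + 1) * (x.2 + 1)) := by
        rw [← sum_antidiagonal_succ_mul_succ, Finset.mul_sum]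
    _ ≤ _ := by
        refine Finset.sum_le_sum fun x hx ↦ ?_
        have := Finset.HasAntidiagonal.mem_antidiagonal.1 hx
        rw [hTc, if_pos (by omega), hD2 _ (by omega)]
        have := hs x.1 (by omega)
        have h2 : 0 ≤ ((x.1 : ℝ) + 1) * (x.2 + 1) := by positivity
        nlinarith

theorem one_div_one_sub_sq_eq (n : ℕ) {x : ℂ} (hx : 1 - x ≠ 0) :
    1 / (1 - x) ^ 2 = ∑ k ∈ Finset.range n, ((k : ℂ) + 1) * x ^ k +
      x ^ n * ((n + 1 - n * x) / (1 - x) ^ 2) := by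
  induction n with
  | zero => simp
  | succ n ih =>
    rw [ih, Finset.sum_range_succ]
    push_cast
    field_simp
    ring

open Polynomial in
/-- A function bounded by `M` which agrees to order `n` at `0` with
`A (1 + r z) ^ 2 / (1 - s z) ^ 2` satisfies `A n ^ 2 / 24 ≤ M`. -/
theorem le_of_eq_kernel_add_pow_mul {n : ℕ} (hn : 1 ≤ n) {r s A M : ℝ} (hr : 0 ≤ r) (hs0 : 0 ≤ s)
    (hs1 : s < 1) (hs : ∀ k < n, 1 / 4 ≤ s ^ k) (hA : 0 ≤ A) {u H : ℂ → ℂ}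
    (hH : DiffContOnCl ℂ H (ball 0 1))
    (hu : ∀ z ∈ sphere (0 : ℂ) 1, u z = A * (1 + r * z) ^ 2 / (1 - s * z) ^ 2 + z ^ n * H z)
    (hM : ∀ z ∈ sphere (0 : ℂ) 1, ‖u z‖ ≤ M) :
    A * (n : ℝ) ^ 2 / 24 ≤ M := by
  have hne : ∀ z ∈ closedBall (0 : ℂ) 1, 1 - (s : ℂ) * z ≠ 0 := by
    intro z hz h
    have hz1 : ‖z‖ ≤ 1 := by simpa using hz
    have : ‖(s : ℂ) * z‖ = 1 := by rw [← sub_eq_zero.1 h]; simp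
    rw [norm_mul, Complex.norm_real, Real.norm_of_nonneg hs0] at this
    nlinarith [norm_nonneg z]
  set Q : ℝ[X] := (1 + C r * X) ^ 2 *
    ∑ k ∈ Finset.range n, C (((k : ℝ) + 1) * s ^ k) * X ^ k with hQ
  set P : ℂ[X] := (C A * Q).map Complex.ofRealHom with hP
  have hR : DiffContOnCl ℂ (fun z : ℂ ↦ A * (1 + r * z) ^ 2 *
      (s ^ n * ((n + 1 - n * (s * z)) / (1 - s * z) ^ 2)) + H z) (ball 0 1) := by
    refine DiffContOnCl.add (DifferentiableOn.diffContOnCl_ball (U := closedBall 0 1) ?_ le_rfl) hH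
    intro z hz
    have h1 := hne z hz
    have : DifferentiableAt ℂ (fun z : ℂ ↦ A * (1 + r * z) ^ 2 *
      (s ^ n * ((n + 1 - n * (s * z)) / (1 - s * z) ^ 2))) z := by
      refine DifferentiableAt.mul (by fun_prop) (DifferentiableAt.mul (by fun_prop) ?_)
      exact DifferentiableAt.div (by fun_prop) (by fun_prop) (pow_ne_zero 2 h1)
    exact this.differentiableWithinAt
  have hPe (z : ℂ) : P.eval z = A * (1 + r * z) ^ 2 *
      ∑ k ∈ Finset.range n, ((k : ℂ) + 1) * (s * z) ^ k := by
    simp [hP, hQ, Polynomial.map_sum, eval_finsetSum, mul_pow, mul_assoc]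
  have key := norm_coeff_mul_sq_le (u := u) hn P hR (fun z hz ↦ ?_) hM
  · have hmap : (P * (∑ k ∈ Finset.range n, (X : ℂ[X]) ^ k) ^ 2).coeff (n - 1) =
        ((A * (Q * (∑ k ∈ Finset.range n, (X : ℝ[X]) ^ k) ^ 2).coeff (n - 1) : ℝ) : ℂ) := by
      have : P * (∑ k ∈ Finset.range n, (X : ℂ[X]) ^ k) ^ 2 =
          (C A * (Q * (∑ k ∈ Finset.range n, (X : ℝ[X]) ^ k) ^ 2)).map Complex.ofRealHom := by
        simp only [hP, Polynomial.map_mul, Polynomial.map_pow, Polynomial.map_sum,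
          Polynomial.map_X, mul_assoc]
      rw [this, coeff_map, coeff_C_mul]
      rfl
    rw [hmap, norm_real] at key
    have h1 := mul_le_mul_of_nonneg_left (le_coeff_mul_sq hn hr hs0 hs) hA
    have h2 := h1.trans ((le_abs_self _).trans key)
    have hn0 : (0 : ℝ) < n := by exact_mod_cast hn
    refine le_of_mul_le_mul_left ?_ hn0
    calc (n : ℝ) * (A * n ^ 2 / 24) = A * (n ^ 3 / 24) := by ring
      _ ≤ _ := h2
  · have h1 := one_div_one_sub_sq_eq n (hne z (sphere_subset_closedBall hz))
    rw [hu z hz, hPe, div_eq_mul_one_div, h1]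
    ring

theorem one_sub_le_norm_one_sub {x : ℂ} {a : ℝ} (hx : ‖x‖ ≤ a) : 1 - a ≤ ‖1 - x‖ := by
  have := norm_sub_norm_le (1 : ℂ) x
  rw [norm_one] at this
  linarith

/-- The `p`-th power of the normalized kernel is dominated by a positive harmonic function
of mean one. -/
theorem norm_kernel_rpow_le {p a : ℝ} (hp : 1 ≤ p) (ha : a < 1) {x : ℂ} (hx : ‖x‖ ≤ a) :
    ‖(((1 - a) ^ (2 - 1 / p) : ℝ) : ℂ) / (1 - x) ^ 2‖ ^ p ≤ ((1 + x) / (1 - x)).re := by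
  have hδ : 0 < 1 - a := by linarith
  have ht := one_sub_le_norm_one_sub hx
  have ht0 : 0 < ‖1 - x‖ := hδ.trans_le ht
  have hp0 : p ≠ 0 := by positivity
  set t := ‖1 - x‖ with htdef
  have hre : ((1 + x) / (1 - x)).re = (1 - ‖x‖ ^ 2) / t ^ 2 := by
    rw [htdef, div_re, ← normSq_eq_norm_sq, ← normSq_eq_norm_sq, normSq_apply x, ← add_div]
    congr 1
    simp
    ring
  have hy0 : 0 < (1 - a) / t := by positivity
  have hy1 : (1 - a) / t ≤ 1 := (div_le_one ht0).2 ht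
  have hnorm : ‖(((1 - a) ^ (2 - 1 / p) : ℝ) : ℂ) / (1 - x) ^ 2‖ =
      ((1 - a) / t) ^ (2 : ℝ) * (1 - a) ^ (-(1 / p)) := by
    rw [norm_div, norm_pow, Complex.norm_real, Real.norm_of_nonneg (by positivity), ← htdef,
      sub_eq_add_neg 2 (1 / p), Real.rpow_add hδ, Real.rpow_two, Real.rpow_two]
    ring
  rw [hnorm, hre, Real.mul_rpow (by positivity) (by positivity), ← Real.rpow_mul hy0.le,
    ← Real.rpow_mul hδ.le]
  calc ((1 - a) / t) ^ (2 * p) * (1 - a) ^ (-(1 / p) * p)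
      ≤ ((1 - a) / t) ^ (2 : ℝ) * (1 - a) ^ (-(1 / p) * p) := by
        refine mul_le_mul_of_nonneg_right ?_ (by positivity)
        exact Real.rpow_le_rpow_of_exponent_ge hy0 hy1 (by linarith)
    _ = (1 - a) / t ^ 2 := by
        rw [show -(1 / p) * p = -1 by field_simp, Real.rpow_neg_one, Real.rpow_two]
        field_simp
    _ ≤ (1 - ‖x‖ ^ 2) / t ^ 2 := by
        refine div_le_div_of_nonneg_right ?_ (by positivity)
        nlinarith [norm_nonneg x]

theorem circleAverage_norm_kernel_rpow_le {p a : ℝ} (hp : 1 ≤ p) (ha : a < 1) {q : ℂ}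
    (hq : ‖q‖ ≤ a) {ρ : ℝ} (hρ0 : 0 ≤ ρ) (hρ : ρ ≤ 1) :
    Real.circleAverage (fun z ↦ ‖(((1 - a) ^ (2 - 1 / p) : ℝ) : ℂ) / (1 - q * z) ^ 2‖ ^ p) 0 ρ
      ≤ 1 := by
  have hx : ∀ z ∈ closedBall (0 : ℂ) ρ, ‖q * z‖ ≤ a := by
    intro z hz
    have hz1 : ‖z‖ ≤ ρ := by simpa using hz
    rw [norm_mul]
    nlinarith [norm_nonneg z, norm_nonneg q]
  have hne : ∀ z ∈ closedBall (0 : ℂ) ρ, 1 - q * z ≠ 0 := by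
    intro z hz h
    have := one_sub_le_norm_one_sub (hx z hz)
    rw [h, norm_zero] at this
    linarith
  set F : ℂ → ℂ := fun z ↦ (1 + q * z) / (1 - q * z) with hF
  have hFd : DifferentiableOn ℂ F (closedBall 0 ρ) := by
    intro z hz
    have : DifferentiableAt ℂ F z :=
      DifferentiableAt.div (by fun_prop) (by fun_prop) (hne z hz)
    exact this.differentiableWithinAt
  have hFc : CircleIntegrable F 0 ρ :=
    (hFd.continuousOn.mono sphere_subset_closedBall).circleIntegrable hρ0
  have hmean : Real.circleAverage (fun z ↦ (F z).re) 0 ρ = 1 := by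
    have h1 := Complex.reCLM.circleAverage_comp_comm hFc
    rw [DiffContOnCl.circleAverage
      (by rw [abs_of_nonneg hρ0]; exact hFd.diffContOnCl_ball le_rfl)] at h1
    simpa [hF, Function.comp_def] using h1
  refine (Real.circleAverage_mono (ContinuousOn.circleIntegrable hρ0 ?_) ?_ ?_).trans_eq hmean
  · refine ContinuousOn.rpow_const (ContinuousOn.norm ?_) fun _ _ ↦ Or.inr (by linarith)
    refine ContinuousOn.div (by fun_prop) (by fun_prop) fun z hz ↦ ?_
    exact pow_ne_zero 2 (hne z (sphere_subset_closedBall hz))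
  · exact (Complex.continuous_re.comp_continuousOn
      (hFd.continuousOn.mono sphere_subset_closedBall)).circleIntegrable hρ0
  · intro z hz
    rw [abs_of_nonneg hρ0] at hz
    exact norm_kernel_rpow_le hp ha (hx z (sphere_subset_closedBall hz))

theorem one_add_mul_ne_zero {r : ℝ} (hr0 : 0 ≤ r) (hr1 : r < 1) {v : ℂ} (hv : ‖v‖ < 1) :
    1 + (r : ℂ) * v ≠ 0 := by
  intro h
  have h1 : ‖(r : ℂ) * v‖ = 1 := by rw [eq_neg_of_add_eq_zero_right h]; simp
  rw [norm_mul, Complex.norm_real, Real.norm_of_nonneg hr0] at h1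
  nlinarith [norm_nonneg v]

theorem norm_add_div_one_add_mul_lt {r : ℝ} (hr0 : 0 ≤ r) (hr1 : r < 1) {v : ℂ} (hv : ‖v‖ < 1) :
    ‖(v + r) / (1 + r * v)‖ < 1 := by
  have h := one_add_mul_ne_zero hr0 hr1 hv
  rw [norm_div, div_lt_one (norm_pos_iff.2 h)]
  refine lt_of_pow_lt_pow_left₀ 2 (norm_nonneg _) ?_
  have hv2 : v.re * v.re + v.im * v.im < 1 := by
    rw [← normSq_apply, normSq_eq_norm_sq]
    nlinarith [norm_nonneg v]
  rw [← normSq_eq_norm_sq, ← normSq_eq_norm_sq, normSq_apply, normSq_apply]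
  simp
  nlinarith [mul_pos (show 0 < 1 - r ^ 2 by nlinarith)
    (show 0 < 1 - (v.re * v.re + v.im * v.im) by linarith)]

theorem blaschkeF_mobius {r : ℝ} (hr0 : 0 ≤ r) (hr1 : r < 1) {η v : ℂ} (hη : ‖η‖ = 1)
    (hv : ‖v‖ < 1) :
    blaschkeF (r * η) (η * ((v + r) / (1 + r * v))) = -η * v := by
  have h := one_add_mul_ne_zero hr0 hr1 hv
  have hη2 : (starRingEnd ℂ) η * η = 1 := by
    rw [mul_comm, mul_conj, normSq_eq_norm_sq, hη]; simp
  have hr2 : (1 : ℂ) - r ^ 2 ≠ 0 := by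
    have : (1 : ℝ) - r ^ 2 ≠ 0 := by nlinarith
    exact_mod_cast this
  have hden : 1 - (starRingEnd ℂ) (r * η) * (η * ((v + r) / (1 + r * v))) =
      (1 - r ^ 2) / (1 + r * v) := by
    rw [map_mul, conj_ofReal]
    calc _ = 1 - r * ((starRingEnd ℂ) η * η) * ((v + r) / (1 + r * v)) := by ring
      _ = _ := by rw [hη2]; field_simp; ring
  rw [blaschkeF, hden]
  field_simp
  ring

theorem kernel_mobius {r s : ℝ} (hr0 : 0 ≤ r) (hr1 : r < 1) (hs0 : 0 ≤ s) (hs1 : s < 1) (K : ℂ)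
    {η v : ℂ} (hη : ‖η‖ = 1) (hv : ‖v‖ < 1) :
    K / (1 - ((r + s) / (1 + s * r) : ℝ) * (starRingEnd ℂ) η * (η * ((v + r) / (1 + r * v)))) ^ 2 =
      K * (((1 + s * r) / (1 - r ^ 2)) ^ 2 : ℝ) * (1 + r * v) ^ 2 / (1 - s * v) ^ 2 := by
  have h := one_add_mul_ne_zero hr0 hr1 hv
  have hη2 : (starRingEnd ℂ) η * η = 1 := by
    rw [mul_comm, mul_conj, normSq_eq_norm_sq, hη]; simp
  have hr2 : (1 : ℂ) - r ^ 2 ≠ 0 := by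
    have : (1 : ℝ) - r ^ 2 ≠ 0 := by nlinarith
    exact_mod_cast this
  have hsr : (1 : ℂ) + s * r ≠ 0 := by
    have : (1 : ℝ) + s * r ≠ 0 := by positivity
    exact_mod_cast this
  have hsv : (1 : ℂ) - s * v ≠ 0 := by
    intro h0
    have h1 : ‖(s : ℂ) * v‖ = 1 := by rw [← sub_eq_zero.1 h0]; simp
    rw [norm_mul, Complex.norm_real, Real.norm_of_nonneg hs0] at h1
    nlinarith [norm_nonneg v]
  have hden : 1 - ((r + s) / (1 + s * r) : ℝ) * (starRingEnd ℂ) η *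
      (η * ((v + r) / (1 + r * v))) =
        (1 - r ^ 2) * (1 - s * v) / ((1 + s * r) * (1 + r * v)) := by
    push_cast
    calc _ = 1 - (r + s) / (1 + s * r) * ((starRingEnd ℂ) η * η) *
          ((v + r) / (1 + r * v)) := by ring
      _ = _ := by
          rw [hη2, mul_one, div_mul_div_comm, eq_div_iff (mul_ne_zero hsr h), sub_mul, one_mul,
            div_mul_cancel₀ _ (mul_ne_zero hsr h)]
          ring
  rw [hden]
  push_cast
  field_simp

theorem rpow_div_le_kernel_const {p : ℝ} (hp : 1 ≤ p) {n : ℕ} (hn : 1 ≤ n) {r s : ℝ}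
    (hr0 : 0 ≤ r) (hr1 : r < 1) (hs : s = 1 - 1 / (2 * n)) :
    1 / 384 * ((n : ℝ) / (1 - r)) ^ (1 / p) ≤
      (1 - (r + s) / (1 + s * r)) ^ (2 - 1 / p) * ((1 + s * r) / (1 - r ^ 2)) ^ 2 * n ^ 2 / 24 := by
  have hn0 : (1 : ℝ) ≤ n := by exact_mod_cast hn
  have hs0 : 0 ≤ s := by
    rw [hs, sub_nonneg, div_le_one (by positivity)]; linarith
  have hr : 0 < 1 - r := by linarith
  have hsr : 0 < 1 + s * r := by positivity
  have hδ : 1 - (r + s) / (1 + s * r) = (1 - r) / (2 * n * (1 + s * r)) := by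
    have h1 : 1 - (r + s) / (1 + s * r) = (1 - s) * (1 - r) / (1 + s * r) := by
      field_simp; ring
    rw [h1, show 1 - s = 1 / (2 * n) by rw [hs]; ring]
    field_simp
  rw [hδ]
  set δ := (1 - r) / (2 * n * (1 + s * r)) with hδdef
  have hδ0 : 0 < δ := by positivity
  have hle : (n : ℝ) / (1 - r) ≤ δ⁻¹ := by
    rw [hδdef, inv_div]
    refine div_le_div_of_nonneg_right ?_ hr.le
    nlinarith [mul_nonneg hs0 hr0]
  have hr2 : 0 < 1 - r ^ 2 := by nlinarith
  have hrp : (1 + r) ≠ 0 := by positivity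
  have hconst : δ ^ 2 * ((1 + s * r) / (1 - r ^ 2)) ^ 2 * n ^ 2 = 1 / (4 * (1 + r) ^ 2) := by
    rw [hδdef, show 1 - r ^ 2 = (1 - r) * (1 + r) by ring]
    field_simp
    norm_num
  have hge : (1 : ℝ) / 16 ≤ 1 / (4 * (1 + r) ^ 2) :=
    one_div_le_one_div_of_le (by positivity) (by nlinarith)
  have hpow : ((n : ℝ) / (1 - r)) ^ (1 / p) ≤ δ⁻¹ ^ (1 / p) :=
    Real.rpow_le_rpow (by positivity) hle (by positivity)
  have hδp : δ ^ (2 - 1 / p) = δ ^ 2 * δ⁻¹ ^ (1 / p) := by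
    rw [Real.rpow_sub hδ0, Real.rpow_two, Real.inv_rpow hδ0.le, div_eq_mul_inv]
  calc 1 / 384 * ((n : ℝ) / (1 - r)) ^ (1 / p) ≤ 1 / 384 * δ⁻¹ ^ (1 / p) := by gcongr
    _ = 1 / 16 * (δ⁻¹ ^ (1 / p) / 24) := by ring
    _ ≤ 1 / (4 * (1 + r) ^ 2) * (δ⁻¹ ^ (1 / p) / 24) := by gcongr
    _ = _ := by rw [← hconst, hδp]; ring

/-- Lower bound in Theorem 2.1, Hardy case: there is `c_p > 0` such that for every
`n ≥ 1` and `λ ∈ D` there is `f ∈ Hol(D)` with `‖f‖_{H^p} ≤ 1` and `‖f‖_{H^∞} < ∞`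
such that every bounded holomorphic `g` interpolating `f` on the one-point sequence
`(λ,…,λ)` of multiplicity `n` satisfies `‖g‖_{H^∞} ≥ c_p (n/(1-|λ|))^{1/p}`. -/
theorem hardy_interpolation_lower_bound (p : ℝ) (hp : 1 ≤ p) :
    ∃ c : ℝ, 0 < c ∧
      ∀ (n : ℕ), 1 ≤ n → ∀ l : ℂ, ‖l‖ < 1 →
      ∃ f : ℂ → ℂ, DifferentiableOn ℂ f (ball (0:ℂ) 1) ∧
        -- `‖f‖_{H^p} ≤ 1`
        (∀ ρ : ℝ, 0 < ρ → ρ < 1 →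
          ((2 * Real.pi)⁻¹ * ∫ θ in (0:ℝ)..(2 * Real.pi),
            ‖f ((ρ : ℂ) * Complex.exp ((θ : ℂ) * Complex.I))‖ ^ p) ≤ 1) ∧
        -- `‖f‖_{H^∞} < ∞`
        (∃ M : ℝ, ∀ z ∈ ball (0:ℂ) 1, ‖f z‖ ≤ M) ∧
        -- every `g ∈ H^∞` with `f - g = b_λ^n ⬝ h` has `sup_D |g| ≥ c (n/(1-|λ|))^{1/p}`
        ∀ g h : ℂ → ℂ, DifferentiableOn ℂ g (ball (0:ℂ) 1) →
          DifferentiableOn ℂ h (ball (0:ℂ) 1) →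
          (∀ z ∈ ball (0:ℂ) 1, f z - g z = (blaschkeF l z) ^ n * h z) →
          ∀ M : ℝ, (∀ z ∈ ball (0:ℂ) 1, ‖g z‖ ≤ M) →
            c * ((n : ℝ) / (1 - ‖l‖)) ^ (1 / p) ≤ M := by
  refine ⟨1 / 384, by norm_num, fun n hn l hl ↦ ?_⟩
  set r : ℝ := ‖l‖ with hr
  have hr0 : 0 ≤ r := norm_nonneg l
  obtain ⟨η, hη, hlη⟩ : ∃ η : ℂ, ‖η‖ = 1 ∧ l = r * η :=
    ⟨exp (arg l * I), norm_exp_ofReal_mul_I _, (norm_mul_exp_arg_mul_I l).symm⟩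
  have hn0 : (1 : ℝ) ≤ n := by exact_mod_cast hn
  set s : ℝ := 1 - 1 / (2 * n) with hs
  have hs1 : s < 1 := by rw [hs]; linarith [show (0 : ℝ) < 1 / (2 * n) by positivity]
  have hs2 : 1 / 2 ≤ s := by
    have : 1 / (2 * (n : ℝ)) ≤ 1 / 2 := one_div_le_one_div_of_le (by norm_num) (by linarith)
    linarith
  have hs0 : 0 ≤ s := by linarith
  have hspow : ∀ k < n, 1 / 4 ≤ (s * s) ^ k := by
    intro k hk
    have hb := one_add_mul_le_pow (a := s - 1) (by linarith) k
    have hkn : (k : ℝ) / n ≤ 1 := (div_le_one (by linarith)).2 (by exact_mod_cast hk.le)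
    have h1 : 1 + (k : ℝ) * (s - 1) = 1 - (k / n) / 2 := by rw [hs]; field_simp; ring
    rw [h1, add_sub_cancel] at hb
    have h2 : 1 / 2 ≤ s ^ k := by linarith
    rw [mul_pow]
    nlinarith
  set a : ℝ := (r + s) / (1 + s * r) with ha
  have hsr : 0 < 1 + s * r := by positivity
  have ha0 : 0 ≤ a := by positivity
  have ha1 : a < 1 := by
    rw [ha, div_lt_one hsr]; nlinarith
  set q : ℂ := a * (starRingEnd ℂ) η with hq
  have hqa : ‖q‖ ≤ a := by
    rw [hq, norm_mul, RCLike.norm_conj, hη, Complex.norm_real, Real.norm_of_nonneg ha0, mul_one]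
  set K : ℝ := (1 - a) ^ (2 - 1 / p) with hK
  have hδ : 0 < 1 - a := by linarith
  have hK0 : 0 ≤ K := by positivity
  have hden : ∀ z ∈ ball (0 : ℂ) 1, 1 - a ≤ ‖1 - q * z‖ := by
    intro z hz
    refine one_sub_le_norm_one_sub ?_
    have hz1 : ‖z‖ < 1 := by simpa using hz
    rw [norm_mul]
    nlinarith [norm_nonneg z, norm_nonneg q]
  refine ⟨fun z ↦ K / (1 - q * z) ^ 2, ?_, ?_, ⟨K / (1 - a) ^ 2, ?_⟩, ?_⟩
  · intro z hz
    have hne : 1 - q * z ≠ 0 := norm_pos_iff.1 (hδ.trans_le (hden z hz))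
    have : DifferentiableAt ℂ (fun z ↦ K / (1 - q * z) ^ 2) z :=
      DifferentiableAt.div (by fun_prop) (by fun_prop) (pow_ne_zero 2 hne)
    exact this.differentiableWithinAt
  · intro ρ hρ0 hρ1
    have := circleAverage_norm_kernel_rpow_le hp ha1 hqa hρ0.le hρ1.le
    simpa only [Real.circleAverage, circleMap, zero_add, smul_eq_mul] using this
  · intro z hz
    rw [norm_div, norm_pow, Complex.norm_real, Real.norm_of_nonneg hK0]
    have := hden z hz
    gcongr
  · intro g h hg hh hgh M hM
    set φ : ℂ → ℂ := fun v ↦ η * (((s : ℂ) * v + r) / (1 + r * (s * v))) with hφ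
    have hsv : ∀ v ∈ closedBall (0 : ℂ) 1, ‖(s : ℂ) * v‖ < 1 := by
      intro v hv
      have hv1 : ‖v‖ ≤ 1 := by simpa using hv
      rw [norm_mul, Complex.norm_real, Real.norm_of_nonneg hs0]
      nlinarith [norm_nonneg v]
    have hφm : Set.MapsTo φ (closedBall 0 1) (ball 0 1) := by
      intro v hv
      rw [mem_ball_zero_iff, hφ, norm_mul, hη, one_mul]
      exact norm_add_div_one_add_mul_lt hr0 hl (hsv v hv)
    have hφd : DifferentiableOn ℂ φ (closedBall 0 1) := by
      intro v hv
      have hne := one_add_mul_ne_zero hr0 hl (hsv v hv)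
      have : DifferentiableAt ℂ φ v :=
        DifferentiableAt.mul (by fun_prop) (DifferentiableAt.div (by fun_prop) (by fun_prop) hne)
      exact this.differentiableWithinAt
    refine (rpow_div_le_kernel_const hp hn hr0 hl hs).trans ?_
    refine le_of_eq_kernel_add_pow_mul (u := g ∘ φ)
      (H := fun v ↦ -(-η * s) ^ n * (h ∘ φ) v) (r := r * s) (s := s * s) hn (by positivity)
      (by positivity) (by nlinarith) hspow (by positivity) ?_ ?_ ?_
    · exact ((hh.comp hφd hφm).const_mul _).diffContOnCl_ball le_rfl
    · intro v hv
      have hvc := sphere_subset_closedBall hv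
      have h1 := hgh (φ v) (hφm hvc)
      have h2 : blaschkeF l (φ v) = -η * (s * v) := by
        rw [hlη]; exact blaschkeF_mobius hr0 hl hη (hsv v hvc)
      have h3 := kernel_mobius hr0 hl hs0 hs1 K hη (hsv v hvc)
      rw [h2] at h1
      have h4 : g (φ v) = K / (1 - q * φ v) ^ 2 - (-η * (s * v)) ^ n * h (φ v) := by
        rw [← h1]; ring
      rw [Function.comp_apply, Function.comp_apply, h4, hq, ha, hφ, h3]
      rw [show -η * ((s : ℂ) * v) = (-η * s) * v by ring, mul_pow _ v]
      push_cast
      ring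
    · intro v hv
      exact hM _ (hφm (sphere_subset_closedBall hv))
end
end

section
/- For every p ∈ [1, ∞) and every β > −1 there exists a constant c > 0 (depending only on p and β) such that: for every n ≥ 1 and every λ ∈ D, there exists f ∈ Hol(D) with ‖f‖_{A^p(β)} ≤ 1 and ‖f‖_{H^∞} < ∞ such that every g ∈ H^∞ satisfying f − g = b_λ^n · h for some h ∈ Hol(D) must satisfy ‖g‖_{H^∞} ≥ c · (n/(1−|λ|))^{(2+β)/p}. (Lower bound in Theorem 2.1, weighted Bergman case, via one-point interpolation sequences.) -/
open Complex Metric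

noncomputable section

/-- The radial-weighted Bergman norm
`‖f‖_{A^p(β)} = (∫_D |f|^p (1-|z|^2)^β dA)^{1/p}`, `dA` normalized area measure. -/
def bergmanNorm (p β : ℝ) (f : ℂ → ℂ) : ℝ :=
  (Real.pi⁻¹ * ∫ z in ball (0:ℂ) 1, ‖f z‖ ^ p * (1 - ‖z‖ ^ 2) ^ β) ^ (1 / p)

/-- The `k`-th Taylor coefficient of `f` at `0`, as an average over the circle of radius `R`. -/
def taylorAvg (R : ℝ) (k : ℕ) (f : ℂ → ℂ) : ℂ :=
  Real.circleAverage (fun w ↦ (w ^ k)⁻¹ * f w) 0 R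

section TaylorAvg

variable {R : ℝ}

lemma circleIntegrable_inv_pow_mul (hR : 0 < R) (k : ℕ) {f : ℂ → ℂ}
    (hf : ContinuousOn f (sphere 0 R)) :
    CircleIntegrable (fun w ↦ (w ^ k)⁻¹ * f w) 0 R := by
  refine ContinuousOn.circleIntegrable hR.le (ContinuousOn.mul ?_ hf)
  refine ContinuousOn.inv₀ (by fun_prop) fun w hw ↦ pow_ne_zero _ ?_
  rintro rfl
  simp [hR.ne] at hw

lemma taylorAvg_congr (hR : 0 < R) (k : ℕ) {f g : ℂ → ℂ} (h : Set.EqOn f g (sphere 0 R)) :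
    taylorAvg R k f = taylorAvg R k g := by
  refine Real.circleAverage_congr_sphere fun w hw ↦ ?_
  rw [abs_of_pos hR] at hw
  simp only [h hw]

lemma taylorAvg_const_mul (k : ℕ) (a : ℂ) (f : ℂ → ℂ) :
    taylorAvg R k (fun w ↦ a * f w) = a * taylorAvg R k f := by
  unfold taylorAvg
  rw [← smul_eq_mul, ← Real.circleAverage_fun_smul]
  simp only [smul_eq_mul, mul_left_comm]

lemma taylorAvg_succ_add (hR : 0 < R) (k : ℕ) {f g : ℂ → ℂ}
    (hf : ContinuousOn f (sphere 0 R)) (hg : ContinuousOn g (sphere 0 R)) :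
    taylorAvg R (k + 1) (fun w ↦ f w + w * g w) = taylorAvg R (k + 1) f + taylorAvg R k g := by
  unfold taylorAvg
  rw [← Real.circleAverage_fun_add (circleIntegrable_inv_pow_mul hR _ hf)
    (circleIntegrable_inv_pow_mul hR _ hg)]
  refine Real.circleAverage_congr_sphere fun w hw ↦ ?_
  have : w ≠ 0 := by
    rintro rfl
    simp [hR.ne', eq_comm] at hw
  field_simp
  ring

lemma taylorAvg_zero (hR : 0 < R) (hR1 : R < 1) {f : ℂ → ℂ}
    (hf : DifferentiableOn ℂ f (ball 0 1)) : taylorAvg R 0 f = f 0 := by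
  unfold taylorAvg
  simp only [pow_zero, inv_one, one_mul]
  apply DiffContOnCl.circleAverage
  rw [abs_of_pos hR]
  exact (hf.mono (closedBall_subset_ball hR1)).diffContOnCl_ball subset_rfl

lemma taylorAvg_succ_one (hR : 0 < R) (k : ℕ) : taylorAvg R (k + 1) (fun _ ↦ 1) = 0 := by
  unfold taylorAvg
  rw [Real.circleAverage_eq_circleIntegral hR.ne']
  have h := circleIntegral.integral_sub_zpow_of_ne (n := -(k + 2 : ℤ)) (by lia) 0 0 R
  rw [smul_eq_zero]
  refine Or.inr (Eq.trans ?_ h)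
  refine circleIntegral.integral_congr hR.le fun w hw ↦ ?_
  simp only [sub_zero, mul_one, smul_eq_mul]
  rw [← mul_inv, ← pow_succ', zpow_neg]
  norm_cast

lemma one_sub_mul_ne_zero {r : ℝ} (hr0 : 0 ≤ r) (hr1 : r < 1) {w : ℂ} (hw : ‖w‖ ≤ 1) :
    1 - (r : ℂ) * w ≠ 0 := by
  intro h
  have h1 : ‖(r : ℂ) * w‖ = 1 := by rw [← sub_eq_zero.mp h, norm_one]
  rw [norm_mul, norm_real, Real.norm_of_nonneg hr0] at h1
  nlinarith [norm_nonneg w]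

lemma differentiableOn_kernel {t r : ℝ} (hr0 : 0 ≤ r) (hr1 : r < 1) (N s : ℕ) :
    DifferentiableOn ℂ (fun w : ℂ ↦ (1 + t * w) ^ N * ((1 - r * w) ^ s)⁻¹) (ball 0 1) := by
  refine DifferentiableOn.mul (by fun_prop) (DifferentiableOn.inv (by fun_prop) fun w hw ↦ ?_)
  exact pow_ne_zero _ (one_sub_mul_ne_zero hr0 hr1 (mem_ball_zero_iff.mp hw).le)

lemma choose_le_re_taylorAvg_inv {r : ℝ} (hR : 0 < R) (hR1 : R < 1) (hr0 : 0 ≤ r) (hr1 : r < 1)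
    (s k : ℕ) :
    (((k + s).choose s : ℕ) : ℝ) * r ^ k
      ≤ (taylorAvg R k (fun w ↦ ((1 - r * w) ^ (s + 1))⁻¹)).re := by
  have hsub : sphere (0 : ℂ) R ⊆ ball 0 1 := sphere_subset_ball hR1
  have hd (m : ℕ) : DifferentiableOn ℂ (fun w : ℂ ↦ ((1 - r * w) ^ m)⁻¹) (ball 0 1) := by
    simpa using differentiableOn_kernel (t := 0) hr0 hr1 0 m
  have hrec (m j : ℕ) : (taylorAvg R (j + 1) (fun w ↦ ((1 - r * w) ^ (m + 1))⁻¹)).re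
      = (taylorAvg R (j + 1) (fun w ↦ ((1 - r * w) ^ m)⁻¹)).re
        + r * (taylorAvg R j (fun w ↦ ((1 - r * w) ^ (m + 1))⁻¹)).re := by
    rw [← re_ofReal_mul, ← add_re, ← taylorAvg_const_mul,
      ← taylorAvg_succ_add hR j ((hd m).continuousOn.mono hsub)
        (((hd (m + 1)).continuousOn.mono hsub).const_mul _)]
    congr 1
    refine taylorAvg_congr hR _ fun w hw ↦ ?_
    have := one_sub_mul_ne_zero hr0 hr1 (mem_ball_zero_iff.mp (hsub hw)).le
    field_simp
    ring
  have hz (m : ℕ) : (taylorAvg R 0 (fun w ↦ ((1 - r * w) ^ m)⁻¹)).re = 1 := by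
    rw [taylorAvg_zero hR hR1 (hd m)]
    simp
  induction s generalizing k with
  | zero =>
    induction k with
    | zero => simpa using (hz 1).ge
    | succ k ih =>
      rw [hrec]
      simp only [pow_zero, inv_one, taylorAvg_succ_one hR, zero_re, zero_add]
      have := mul_le_mul_of_nonneg_left ih hr0
      simp only [add_zero, Nat.choose_zero_right, Nat.cast_one, one_mul, zero_add] at this ⊢
      rw [pow_succ']
      exact this
  | succ s ih =>
    induction k with
    | zero => simp [hz]
    | succ k ihk =>
      rw [hrec]
      have h1 := mul_le_mul_of_nonneg_left ihk hr0
      have h2 := ih (k + 1)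
      have h3 : (k + 1 + (s + 1)).choose (s + 1)
          = (k + 1 + s).choose s + (k + (s + 1)).choose (s + 1) := by
        rw [show k + 1 + (s + 1) = (k + 1 + s) + 1 by ring, Nat.choose_succ_succ,
          show k + 1 + s = k + (s + 1) by ring]
      rw [h3]
      push_cast
      rw [pow_succ'] at h2 ⊢
      linarith

lemma choose_le_re_taylorAvg {t r : ℝ} (ht : 0 ≤ t) (hR : 0 < R) (hR1 : R < 1) (hr0 : 0 ≤ r)
    (hr1 : r < 1) (s N k : ℕ) :
    (((k + s).choose s : ℕ) : ℝ) * r ^ k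
      ≤ (taylorAvg R k (fun w ↦ (1 + t * w) ^ N * ((1 - r * w) ^ (s + 1))⁻¹)).re := by
  have hsub : sphere (0 : ℂ) R ⊆ ball 0 1 := sphere_subset_ball hR1
  have hd (m : ℕ) := differentiableOn_kernel (t := t) hr0 hr1 m (s + 1)
  induction N generalizing k with
  | zero => simpa using choose_le_re_taylorAvg_inv hR hR1 hr0 hr1 s k
  | succ N ih =>
    cases k with
    | zero =>
      rw [taylorAvg_zero hR hR1 (hd _)]
      simp
    | succ k =>
      have hrec : taylorAvg R (k + 1)
            (fun w ↦ (1 + t * w) ^ (N + 1) * ((1 - r * w) ^ (s + 1))⁻¹)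
          = taylorAvg R (k + 1) (fun w ↦ (1 + t * w) ^ N * ((1 - r * w) ^ (s + 1))⁻¹)
            + t * taylorAvg R k (fun w ↦ (1 + t * w) ^ N * ((1 - r * w) ^ (s + 1))⁻¹) := by
        rw [← taylorAvg_const_mul, ← taylorAvg_succ_add hR k ((hd N).continuousOn.mono hsub)
          (((hd N).continuousOn.mono hsub).const_mul _)]
        exact taylorAvg_congr hR _ fun w _ ↦ by ring
      rw [hrec, add_re, re_ofReal_mul]
      have h0 : 0 ≤ (((k + s).choose s : ℕ) : ℝ) * r ^ k := by positivity
      have := mul_nonneg ht (h0.trans (ih k))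
      linarith [ih (k + 1)]

lemma norm_circleAverage_le_s3 {f : ℂ → ℂ} {c : ℂ} :
    ‖Real.circleAverage f c R‖ ≤ Real.circleAverage (fun w ↦ ‖f w‖) c R := by
  rw [Real.circleAverage_def, Real.circleAverage_def, norm_smul, smul_eq_mul,
    Real.norm_of_nonneg (by positivity)]
  gcongr
  exact intervalIntegral.norm_integral_le_integral_norm Real.two_pi_pos.le

lemma circleAverage_inv_norm_sq_le {r : ℝ} (hR : 0 < R) (hR1 : R < 1) (hr0 : 0 ≤ r)
    (hr1 : r < 1) :
    Real.circleAverage (fun w : ℂ ↦ (‖1 - r * w‖ ^ 2)⁻¹) 0 R ≤ (1 - r)⁻¹ := by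
  have hrR : r * R < 1 := by nlinarith
  have hpos : 0 < 1 - r ^ 2 * R ^ 2 := by nlinarith [mul_nonneg hr0 hR.le]
  have hw : ((r * R ^ 2 : ℝ) : ℂ) ∈ ball (0 : ℂ) R := by
    rw [mem_ball_zero_iff, norm_real, Real.norm_of_nonneg (by positivity)]
    nlinarith
  have h := (InnerProductSpace.harmonicOnNhd_const (s := closedBall (0 : ℂ) R)
    (1 : ℝ)).circleAverage_poissonKernel_smul hw
  have hcongr : Real.circleAverage (poissonKernel 0 ((r * R ^ 2 : ℝ) : ℂ) • fun _ ↦ (1 : ℝ)) 0 R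
      = Real.circleAverage
        (fun w : ℂ ↦ (1 - r ^ 2 * R ^ 2) • (‖1 - r * w‖ ^ 2)⁻¹) 0 R := by
    refine Real.circleAverage_congr_sphere fun w hw ↦ ?_
    rw [abs_of_pos hR] at hw
    have hwn : ‖w‖ = R := by simpa using hw
    have hdist : ‖w - ((r * R ^ 2 : ℝ) : ℂ)‖ ^ 2 = R ^ 2 * ‖1 - r * w‖ ^ 2 := by
      have h1 : w.re * w.re + w.im * w.im = R ^ 2 := by
        rw [← normSq_apply, normSq_eq_norm_sq, hwn]
      simp only [← normSq_eq_norm_sq, normSq_apply, sub_re, sub_im, ofReal_re, ofReal_im,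
        one_re, one_im, re_ofReal_mul, im_ofReal_mul]
      linear_combination (1 - r ^ 2 * R ^ 2) * h1
    have hne := norm_pos_iff.mpr
      (one_sub_mul_ne_zero hr0 hr1 (hwn.trans_le hR1.le))
    simp only [Pi.smul_apply', poissonKernel_def, sub_zero, hdist, hwn, smul_eq_mul, mul_one,
      norm_real, Real.norm_of_nonneg (show 0 ≤ r * R ^ 2 by positivity)]
    field_simp
  rw [hcongr, Real.circleAverage_fun_smul, smul_eq_mul] at h
  rw [eq_inv_of_mul_eq_one_right h]
  gcongr
  · nlinarith [mul_le_mul_of_nonneg_left hR1.le hr0, mul_nonneg hr0 hR.le]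

lemma norm_taylorAvg_le {r M : ℝ} (hR : 0 < R) (hR1 : R < 1) (hr0 : 0 ≤ r) (hr1 : r < 1)
    (k : ℕ) {G : ℂ → ℂ} (hG : ContinuousOn G (ball 0 1)) (hM : ∀ w ∈ ball (0 : ℂ) 1, ‖G w‖ ≤ M) :
    ‖taylorAvg R k (fun w ↦ G w * ((1 - r * w) ^ 2)⁻¹)‖ ≤ (R ^ k)⁻¹ * M * (1 - r)⁻¹ := by
  have hM0 : 0 ≤ M := (norm_nonneg _).trans (hM 0 (by simp))
  have hsub : sphere (0 : ℂ) R ⊆ ball 0 1 := sphere_subset_ball hR1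
  have hne : ∀ w ∈ sphere (0 : ℂ) R, 1 - (r : ℂ) * w ≠ 0 := fun w hw ↦
    one_sub_mul_ne_zero hr0 hr1 (mem_ball_zero_iff.mp (hsub hw)).le
  have hc : ContinuousOn (fun w : ℂ ↦ ((1 - r * w) ^ 2)⁻¹) (sphere 0 R) :=
    ContinuousOn.inv₀ (by fun_prop) fun w hw ↦ pow_ne_zero _ (hne w hw)
  have hi : CircleIntegrable (fun w : ℂ ↦ (‖1 - r * w‖ ^ 2)⁻¹) 0 R :=
    ContinuousOn.circleIntegrable hR.le (ContinuousOn.inv₀ (by fun_prop) fun w hw ↦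
      pow_ne_zero _ (norm_ne_zero_iff.mpr (hne w hw)))
  refine norm_circleAverage_le_s3.trans ?_
  calc _ ≤ Real.circleAverage (fun w : ℂ ↦ ((R ^ k)⁻¹ * M) • (‖1 - r * w‖ ^ 2)⁻¹) 0 R := by
        refine Real.circleAverage_mono
          (circleIntegrable_inv_pow_mul hR k ((hG.mono hsub).mul hc)).norm
          (hi.const_smul (a := (R ^ k)⁻¹ * M)) fun w hw ↦ ?_
        rw [abs_of_pos hR] at hw
        have hwn : ‖w‖ = R := by simpa using hw
        rw [norm_mul, norm_mul, norm_inv, norm_inv, norm_pow, norm_pow, hwn, smul_eq_mul,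
          mul_assoc]
        have := hM w (hsub hw)
        gcongr
    _ ≤ _ := by
        rw [Real.circleAverage_fun_smul, smul_eq_mul]
        have := circleAverage_inv_norm_sq_le hR hR1 hr0 hr1
        gcongr

lemma choose_mul_pow_le_of_interpolates {t r M : ℝ} (ht : 0 ≤ t) (hR : 0 < R) (hR1 : R < 1)
    (hr0 : 0 ≤ r) (hr1 : r < 1) (N k : ℕ) {B : ℝ} (hB : 0 ≤ B) {G H : ℂ → ℂ}
    (hG : DifferentiableOn ℂ G (ball 0 1)) (hH : DifferentiableOn ℂ H (ball 0 1))
    (hM : ∀ w ∈ ball (0 : ℂ) 1, ‖G w‖ ≤ M)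
    (h : ∀ w ∈ ball (0 : ℂ) 1,
      B * ((1 + t * w) / (1 - r * w)) ^ N = G w + w ^ (k + 1) * H w) :
    B * ((((k + (N + 1)).choose (N + 1) : ℕ) : ℝ) * r ^ k) ≤ (R ^ k)⁻¹ * M * (1 - r)⁻¹ := by
  have hsub : sphere (0 : ℂ) R ⊆ ball 0 1 := sphere_subset_ball hR1
  have hd : DifferentiableOn ℂ (fun w : ℂ ↦ ((1 - r * w) ^ 2)⁻¹) (ball 0 1) := by
    simpa using differentiableOn_kernel (t := 0) hr0 hr1 0 2
  have hdH : DifferentiableOn ℂ (fun w ↦ w * (H w * ((1 - r * w) ^ 2)⁻¹)) (ball 0 1) :=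
    differentiableOn_id.mul (hH.mul hd)
  have key : taylorAvg R k (fun w ↦ B * ((1 + t * w) ^ N * ((1 - r * w) ^ (N + 1 + 1))⁻¹))
      = taylorAvg R k (fun w ↦ G w * ((1 - r * w) ^ 2)⁻¹) := by
    have h0 := taylorAvg_zero hR hR1 hdH
    rw [zero_mul] at h0
    rw [← add_zero (taylorAvg R k (fun w ↦ G w * _)), ← h0]
    unfold taylorAvg
    rw [← Real.circleAverage_fun_add
      (circleIntegrable_inv_pow_mul hR _
        ((hG.continuousOn.mono hsub).fun_mul (hd.continuousOn.mono hsub)))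
      (circleIntegrable_inv_pow_mul hR _ (hdH.continuousOn.mono hsub))]
    refine Real.circleAverage_congr_sphere fun w hw ↦ ?_
    rw [abs_of_pos hR] at hw
    have hw0 : w ≠ 0 := by
      rintro rfl
      simp [hR.ne] at hw
    have hne := one_sub_mul_ne_zero hr0 hr1 (mem_ball_zero_iff.mp (hsub hw)).le
    have hG' := eq_sub_of_add_eq (h w (hsub hw)).symm
    simp only [hG', div_pow, pow_zero, inv_one, one_mul]
    generalize 1 - (r : ℂ) * w = d at hne
    field_simp
    ring
  rw [taylorAvg_const_mul] at key
  calc _ ≤ B * (taylorAvg R k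
        (fun w ↦ ((1 + t * w) ^ N * ((1 - r * w) ^ (N + 1 + 1))⁻¹))).re :=
        mul_le_mul_of_nonneg_left (choose_le_re_taylorAvg ht hR hR1 hr0 hr1 _ _ _) hB
    _ = (taylorAvg R k (fun w ↦ G w * ((1 - r * w) ^ 2)⁻¹)).re := by rw [← key, re_ofReal_mul]
    _ ≤ _ := (re_le_norm _).trans (norm_taylorAvg_le hR hR1 hr0 hr1 k hG.continuousOn hM)

end TaylorAvg

section IntegralEstimate

open MeasureTheory

lemma sq_add_sq_le_norm_sq {d x θ : ℝ} (hd : 0 < d) (hx0 : 0 ≤ x) (hx : x ≤ 1 - d)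
    (hθ : |θ| ≤ Real.pi) :
    d ^ 2 + θ ^ 2 ≤ 44 * ‖1 - x * (Real.cos θ + Real.sin θ * I)‖ ^ 2 := by
  have hcos := Real.cos_le_one_sub_mul_cos_sq hθ
  have hpi : Real.pi ^ 2 ≤ 10 := by nlinarith [Real.pi_lt_d2, Real.pi_gt_three]
  have hθ2 : θ ^ 2 ≤ Real.pi ^ 2 := sq_le_sq' (by linarith [neg_le_of_abs_le hθ])
    (le_of_abs_le hθ)
  have hc : 1 / 5 * θ ^ 2 ≤ 1 - Real.cos θ := by
    have : 1 / 5 ≤ 2 / Real.pi ^ 2 := by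
      rw [div_le_div_iff₀ (by norm_num) (by positivity)]
      linarith
    nlinarith [mul_le_mul_of_nonneg_right this (sq_nonneg θ)]
  have hn : ‖1 - x * (Real.cos θ + Real.sin θ * I)‖ ^ 2
      = (1 - x) ^ 2 + 2 * x * (1 - Real.cos θ) := by
    rw [← normSq_eq_norm_sq, normSq_apply]
    simp only [sub_re, sub_im, one_re, one_im, re_ofReal_mul, im_ofReal_mul, add_re, add_im,
      ofReal_re, ofReal_im, I_re, I_im]
    linear_combination x ^ 2 * Real.sin_sq_add_cos_sq θ
  rw [hn]
  rcases le_total (1 / 2) x with h | h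
  · nlinarith [mul_nonneg (sub_nonneg.mpr h) (hc.trans' (by positivity)), sq_nonneg θ]
  · nlinarith [mul_nonneg hx0 (hc.trans' (by positivity))]

/-- The radial profile dominating the integrand of the Forelli–Rudin estimate. -/
def radialProfile (β a : ℝ) : ℝ → ℝ :=
  Set.indicator (Set.Ioi 0) fun x ↦ x ^ β * max 1 x ^ (-a)

lemma radialProfile_nonneg (β a x : ℝ) : 0 ≤ radialProfile β a x :=
  Set.indicator_nonneg (fun x (hx : 0 < x) ↦ by positivity) x

lemma integrable_radialProfile {β a : ℝ} (hβ : -1 < β) (ha : β + 1 < a) :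
    Integrable (radialProfile β a) := by
  unfold radialProfile
  rw [integrable_indicator_iff measurableSet_Ioi, ← Set.Ioc_union_Ioi_eq_Ioi zero_le_one]
  refine IntegrableOn.union ?_ ?_
  · have h : IntegrableOn (fun x : ℝ ↦ x ^ β) (Set.Ioc 0 1) :=
      (intervalIntegrable_iff_integrableOn_Ioc_of_le zero_le_one).mp
        (intervalIntegral.intervalIntegrable_rpow' hβ)
    refine h.congr_fun (fun x hx ↦ ?_) measurableSet_Ioc
    simp [max_eq_left hx.2]
  · have h : IntegrableOn (fun x : ℝ ↦ x ^ (β - a)) (Set.Ioi 1) :=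
      integrableOn_Ioi_rpow_of_lt (by linarith) one_pos
    refine h.congr_fun (fun x (hx : 1 < x) ↦ ?_) measurableSet_Ioi
    simp only
    rw [max_eq_right hx.le, sub_eq_add_neg, Real.rpow_add (one_pos.trans hx)]

lemma one_sub_sq_rpow_le (β : ℝ) {t : ℝ} (ht0 : 0 ≤ t) (ht1 : t < 1) :
    (1 - t ^ 2) ^ β ≤ 2 ^ |β| * (1 - t) ^ β := by
  rw [show 1 - t ^ 2 = (1 + t) * (1 - t) by ring,
    Real.mul_rpow (by linarith) (by linarith)]
  have h1 : (1 + t) ^ β ≤ 2 ^ |β| :=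
    (Real.rpow_le_rpow_of_exponent_le (by linarith) (le_abs_self β)).trans
      (Real.rpow_le_rpow (by linarith) (by linarith) (abs_nonneg β))
  exact mul_le_mul_of_nonneg_right h1 (Real.rpow_nonneg (by linarith) _)

lemma kernel_polar_le {β q ρ t θ : ℝ} (hq : 2 ≤ q) (hρ0 : 0 ≤ ρ) (hρ1 : ρ < 1)
    (ht0 : 0 < t) (ht1 : t < 1) (hθ : |θ| ≤ Real.pi) :
    ‖1 - ρ * (t * (Real.cos θ + Real.sin θ * I))‖ ^ (-q) * (1 - t ^ 2) ^ β
      ≤ 44 * 2 ^ |β| * (1 - ρ) ^ (β - q) *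
        (radialProfile β (q - 2) ((1 - t) / (1 - ρ)) * (1 + (θ / (1 - ρ)) ^ 2)⁻¹) := by
  set d := 1 - ρ with hd
  have hd0 : 0 < d := by linarith
  have hs0 : 0 < 1 - t := by linarith
  set X := ‖1 - ρ * (t * (Real.cos θ + Real.sin θ * I))‖ with hX
  have hX2 : d ^ 2 + θ ^ 2 ≤ 44 * X ^ 2 := by
    have := sq_add_sq_le_norm_sq (x := ρ * t) hd0 (by positivity) (by nlinarith) hθ
    rwa [ofReal_mul, mul_assoc] at this
  have hXm : max d (1 - t) ≤ X := by
    have h1 : ‖(ρ : ℂ) * (t * (Real.cos θ + Real.sin θ * I))‖ = ρ * t := by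
      have h2 : ‖(Real.cos θ : ℂ) + Real.sin θ * I‖ = 1 := by
        rw [ofReal_cos, ofReal_sin, ← exp_mul_I, norm_exp_ofReal_mul_I]
      rw [norm_mul, norm_mul, h2, norm_real, norm_real, Real.norm_of_nonneg hρ0,
        Real.norm_of_nonneg ht0.le, mul_one]
    have h3 := norm_sub_norm_le (1 : ℂ) (ρ * (t * (Real.cos θ + Real.sin θ * I)))
    rw [norm_one, h1] at h3
    refine le_trans (max_le ?_ ?_) h3 <;> nlinarith
  have hm0 : 0 < max d (1 - t) := lt_max_of_lt_left hd0
  have hX0 : 0 < X := hm0.trans_le hXm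
  have e1 : X ^ (-q) = (X ^ 2)⁻¹ * X ^ (-(q - 2)) := by
    rw [← Real.rpow_two, ← Real.rpow_neg hX0.le, ← Real.rpow_add hX0]
    ring_nf
  have e2 : (X ^ 2)⁻¹ ≤ 44 * (d ^ 2)⁻¹ * (1 + (θ / d) ^ 2)⁻¹ := by
    have : 44 * (d ^ 2)⁻¹ * (1 + (θ / d) ^ 2)⁻¹ = ((d ^ 2 + θ ^ 2) / 44)⁻¹ := by field_simp
    rw [this]
    gcongr
    linarith
  have e3 : X ^ (-(q - 2)) ≤ max d (1 - t) ^ (-(q - 2)) :=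
    Real.rpow_le_rpow_of_nonpos hm0 hXm (by linarith)
  have e4 := one_sub_sq_rpow_le β ht0.le ht1
  have e5 : max d (1 - t) ^ (-(q - 2)) * (1 - t) ^ β
      = d ^ (β - q) * d ^ 2 * radialProfile β (q - 2) ((1 - t) / d) := by
    have hs : 1 - t = d * ((1 - t) / d) := by field_simp
    have hx0 : 0 < (1 - t) / d := by positivity
    have hmax : max d (1 - t) = d * max 1 ((1 - t) / d) := by
      rw [mul_max_of_nonneg _ _ hd0.le, mul_one, ← hs]
    rw [radialProfile, Set.indicator_of_mem (Set.mem_Ioi.mpr hx0), hmax]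
    nth_rewrite 2 [hs]
    rw [Real.mul_rpow hd0.le (by positivity), Real.mul_rpow hd0.le hx0.le, ← Real.rpow_two,
      ← Real.rpow_add hd0, show β - q + 2 = -(q - 2) + β by ring, Real.rpow_add hd0]
    ring
  calc X ^ (-q) * (1 - t ^ 2) ^ β
      ≤ (44 * (d ^ 2)⁻¹ * (1 + (θ / d) ^ 2)⁻¹ * max d (1 - t) ^ (-(q - 2)))
        * (2 ^ |β| * (1 - t) ^ β) := by
        rw [e1]
        have : 0 ≤ (1 - t ^ 2) ^ β := Real.rpow_nonneg (by nlinarith) _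
        gcongr
    _ = 44 * 2 ^ |β| * (d ^ 2)⁻¹ * (1 + (θ / d) ^ 2)⁻¹
        * (max d (1 - t) ^ (-(q - 2)) * (1 - t) ^ β) := by ring
    _ = _ := by
        rw [e5]
        field_simp

lemma setIntegral_kernel_le {β q ρ : ℝ} (hβ : -1 < β) (hq : β + 3 < q) (hρ0 : 0 ≤ ρ)
    (hρ1 : ρ < 1) :
    ∫ z in ball (0 : ℂ) 1, ‖1 - ρ * z‖ ^ (-q) * (1 - ‖z‖ ^ 2) ^ β
      ≤ 44 * 2 ^ |β| * (∫ x, radialProfile β (q - 2) x) * Real.pi * (1 - ρ) ^ (β + 2 - q) := by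
  have hd0 : 0 < 1 - ρ := by linarith
  set C := 44 * 2 ^ |β| * (1 - ρ) ^ (β - q) with hC
  have hC0 : 0 ≤ C := by positivity
  have hG1 : Integrable (fun t ↦ radialProfile β (q - 2) ((1 - t) / (1 - ρ))) :=
    ((integrable_radialProfile hβ (by linarith : β + 1 < q - 2)).comp_div hd0.ne').comp_sub_left 1
  have hG2 : Integrable (fun θ : ℝ ↦ (1 + (θ / (1 - ρ)) ^ 2)⁻¹) :=
    integrable_inv_one_add_sq.comp_div hd0.ne'
  have hG : Integrable (fun p : ℝ × ℝ ↦ C * (radialProfile β (q - 2) ((1 - p.1) / (1 - ρ))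
      * (1 + (p.2 / (1 - ρ)) ^ 2)⁻¹)) := (hG1.mul_prod hG2).const_mul C
  have hG0 (p : ℝ × ℝ) : 0 ≤ C * (radialProfile β (q - 2) ((1 - p.1) / (1 - ρ))
      * (1 + (p.2 / (1 - ρ)) ^ 2)⁻¹) :=
    mul_nonneg hC0 (mul_nonneg (radialProfile_nonneg _ _ _) (by positivity))
  rw [← integral_indicator measurableSet_ball, ← Complex.integral_comp_polarCoord_symm]
  calc _ ≤ ∫ p in polarCoord.target, C * (radialProfile β (q - 2) ((1 - p.1) / (1 - ρ))
          * (1 + (p.2 / (1 - ρ)) ^ 2)⁻¹) := by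
        refine integral_mono_of_nonneg ?_ hG.integrableOn ?_
        · refine ae_restrict_of_forall_mem polarCoord.open_target.measurableSet fun p hp ↦ ?_
          refine smul_nonneg (le_of_lt hp.1) (Set.indicator_nonneg (fun z hz ↦ ?_) _)
          have : ‖z‖ < 1 := mem_ball_zero_iff.mp hz
          exact mul_nonneg (by positivity)
            (Real.rpow_nonneg (by nlinarith [norm_nonneg z]) _)
        · refine ae_restrict_of_forall_mem polarCoord.open_target.measurableSet fun p hp ↦ ?_
          have hp1 : 0 < p.1 := hp.1
          have hp2 : |p.2| ≤ Real.pi := abs_le.mpr ⟨hp.2.1.le, hp.2.2.le⟩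
          have hn : ‖Complex.polarCoord.symm p‖ = p.1 := by
            rw [Complex.norm_polarCoord_symm, abs_of_pos hp1]
          by_cases h1 : p.1 < 1
          · simp only
            rw [Set.indicator_of_mem (by rwa [mem_ball_zero_iff, hn]), hn,
              Complex.polarCoord_symm_apply, smul_eq_mul]
            refine le_trans ?_ (kernel_polar_le (by linarith) hρ0 hρ1 hp1 h1 hp2)
            refine mul_le_of_le_one_left (mul_nonneg (by positivity)
              (Real.rpow_nonneg (by nlinarith) _)) h1.le
          · simp only
            rw [Set.indicator_of_notMem (by rwa [mem_ball_zero_iff, hn]), smul_zero]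
            exact hG0 p
    _ ≤ ∫ p : ℝ × ℝ, C * (radialProfile β (q - 2) ((1 - p.1) / (1 - ρ))
          * (1 + (p.2 / (1 - ρ)) ^ 2)⁻¹) :=
        setIntegral_le_integral hG (Filter.Eventually.of_forall hG0)
    _ = _ := by
        rw [integral_const_mul]
        rw [Measure.volume_eq_prod, integral_prod_mul
          (fun t ↦ radialProfile β (q - 2) ((1 - t) / (1 - ρ)))
          (fun θ : ℝ ↦ (1 + (θ / (1 - ρ)) ^ 2)⁻¹),
          integral_sub_left_eq_self (fun s ↦ radialProfile β (q - 2) (s / (1 - ρ))),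
          Measure.integral_comp_div, Measure.integral_comp_div (fun θ : ℝ ↦ (1 + θ ^ 2)⁻¹),
          integral_univ_inv_one_add_sq, abs_of_pos hd0, smul_eq_mul, smul_eq_mul, hC,
          show β + 2 - q = β - q + 2 by ring, Real.rpow_add hd0, Real.rpow_two]
        ring

lemma setIntegral_kernel_rotate_le {β q ρ : ℝ} (hβ : -1 < β) (hq : β + 3 < q) (hρ0 : 0 ≤ ρ)
    (hρ1 : ρ < 1) (u : Circle) :
    ∫ z in ball (0 : ℂ) 1, ‖1 - ρ * ((u : ℂ) * z)‖ ^ (-q) * (1 - ‖z‖ ^ 2) ^ β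
      ≤ 44 * 2 ^ |β| * (∫ x, radialProfile β (q - 2) x) * Real.pi * (1 - ρ) ^ (β + 2 - q) := by
  refine le_of_eq_of_le ?_ (setIntegral_kernel_le hβ hq hρ0 hρ1)
  have h := (rotation u).measurePreserving.setIntegral_preimage_emb
    (rotation u).toHomeomorph.measurableEmbedding
    (fun z ↦ ‖1 - ρ * z‖ ^ (-q) * (1 - ‖z‖ ^ 2) ^ β) (ball 0 1)
  simpa only [LinearIsometryEquiv.preimage_ball, map_zero, rotation_apply, norm_mul,
    Circle.norm_coe, one_mul] using h

end IntegralEstimate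

section Extremal

/-- The disc automorphism `w ↦ u (t + w) / (1 + t w)` sending `0` to `u t`. -/
def discAut (u : Circle) (t : ℝ) (w : ℂ) : ℂ := u * ((t + w) / (1 + t * w))

/-- A normalised reproducing-kernel power peaking at the boundary point `u`. -/
def peak (A ρ : ℝ) (u : Circle) (N : ℕ) (z : ℂ) : ℂ :=
  A * ((1 - ρ * (((u⁻¹ : Circle) : ℂ) * z)) ^ N)⁻¹

variable {t : ℝ} {u : Circle}

lemma one_add_mul_ne_zero_s3 (ht0 : 0 ≤ t) (ht1 : t < 1) {w : ℂ} (hw : ‖w‖ ≤ 1) :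
    1 + (t : ℂ) * w ≠ 0 := by
  simpa using one_sub_mul_ne_zero ht0 ht1 ((norm_neg w).trans_le hw)

lemma differentiableOn_discAut (ht0 : 0 ≤ t) (ht1 : t < 1) :
    DifferentiableOn ℂ (discAut u t) (ball 0 1) :=
  (DifferentiableOn.div (by fun_prop) (by fun_prop) fun _ hw ↦
    one_add_mul_ne_zero_s3 ht0 ht1 (mem_ball_zero_iff.mp hw).le).const_mul _

lemma mapsTo_discAut (ht0 : 0 ≤ t) (ht1 : t < 1) :
    Set.MapsTo (discAut u t) (ball 0 1) (ball 0 1) := by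
  intro w hw
  rw [mem_ball_zero_iff] at hw ⊢
  have hne := one_add_mul_ne_zero_s3 ht0 ht1 hw.le
  rw [discAut, norm_mul, Circle.norm_coe, one_mul, norm_div, div_lt_one (norm_pos_iff.mpr hne)]
  refine lt_of_pow_lt_pow_left₀ 2 (norm_nonneg _) ?_
  have h1 : w.re * w.re + w.im * w.im < 1 := by
    rw [← normSq_apply, normSq_eq_norm_sq]
    nlinarith [norm_nonneg w]
  simp only [← normSq_eq_norm_sq, normSq_apply, add_re, add_im, ofReal_re, ofReal_im,
    one_re, one_im, re_ofReal_mul, im_ofReal_mul]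
  nlinarith [mul_pos (sub_pos.mpr h1) (show 0 < 1 - t * t by nlinarith)]

lemma blaschkeF_discAut (ht0 : 0 ≤ t) (ht1 : t < 1) {w : ℂ} (hw : ‖w‖ ≤ 1) :
    blaschkeF (t * u) (discAut u t w) = -u * w := by
  have hne := one_add_mul_ne_zero_s3 ht0 ht1 hw
  have hu : (starRingEnd ℂ) (u : ℂ) * u = 1 := by
    rw [mul_comm, mul_conj, Circle.normSq_coe, ofReal_one]
  have hden : 1 - (starRingEnd ℂ) (t * u) * discAut u t w = (1 - t ^ 2) / (1 + t * w) := by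
    rw [discAut, map_mul, conj_ofReal]
    field_simp
    linear_combination (-(t : ℂ) * (t + w)) * hu
  have ht2 : (1 : ℂ) - t ^ 2 ≠ 0 := by
    norm_cast
    nlinarith
  rw [blaschkeF, hden, discAut]
  field_simp
  ring

lemma peak_discAut {A r ρ : ℝ} (N : ℕ) (ht0 : 0 ≤ t) (ht1 : t < 1) (hr0 : 0 ≤ r)
    (hρ : ρ = (t + r) / (1 + r * t)) {w : ℂ} (hw : ‖w‖ ≤ 1) :
    peak A ρ u N (discAut u t w)
      = ((A * ((1 - ρ * t) ^ N)⁻¹ : ℝ) : ℂ) * ((1 + t * w) / (1 - r * w)) ^ N := by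
  have hne := one_add_mul_ne_zero_s3 ht0 ht1 hw
  have hrt : (1 : ℂ) + t * r ≠ 0 := by
    norm_cast
    positivity
  have hu : ((u⁻¹ : Circle) : ℂ) * discAut u t w = (t + w) / (1 + t * w) := by
    rw [discAut, ← mul_assoc, ← Circle.coe_mul, inv_mul_cancel, Circle.coe_one, one_mul]
  have h : 1 - (ρ : ℂ) * ((t + w) / (1 + t * w))
      = (1 - ρ * t) * ((1 - r * w) / (1 + t * w)) := by
    rw [hρ]
    push_cast
    rw [mul_comm (r : ℂ) t]
    field_simp
    ring
  rw [peak, hu, h, mul_pow]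
  push_cast
  rw [mul_inv, ← inv_pow ((1 - (r : ℂ) * w) / _), inv_div, mul_assoc]

lemma one_sub_le_norm {ρ : ℝ} (hρ0 : 0 ≤ ρ) {z : ℂ} (hz : ‖z‖ ≤ 1) :
    1 - ρ ≤ ‖1 - ρ * ((u : ℂ) * z)‖ := by
  have h := norm_sub_norm_le (1 : ℂ) (ρ * (u * z))
  rw [norm_one, norm_mul, norm_mul, Circle.norm_coe, one_mul, norm_real,
    Real.norm_of_nonneg hρ0] at h
  nlinarith [norm_nonneg z]

lemma differentiableOn_peak {A ρ : ℝ} (hρ0 : 0 ≤ ρ) (hρ1 : ρ < 1) (N : ℕ) :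
    DifferentiableOn ℂ (peak A ρ u N) (ball 0 1) := by
  refine DifferentiableOn.const_mul (DifferentiableOn.inv (by fun_prop) fun z hz ↦
    pow_ne_zero _ (norm_pos_iff.mp ?_)) _
  have := one_sub_le_norm (u := u⁻¹) hρ0 (mem_ball_zero_iff.mp hz).le
  linarith

lemma norm_peak_le {A ρ : ℝ} (hA : 0 ≤ A) (hρ0 : 0 ≤ ρ) (hρ1 : ρ < 1) (N : ℕ) {z : ℂ}
    (hz : ‖z‖ ≤ 1) : ‖peak A ρ u N z‖ ≤ A * ((1 - ρ) ^ N)⁻¹ := by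
  have := one_sub_le_norm (u := u⁻¹) hρ0 hz
  have h0 : 0 < 1 - ρ := by linarith
  rw [peak, norm_mul, norm_inv, norm_pow, norm_real, Real.norm_of_nonneg hA]
  gcongr

lemma exists_bergmanNorm_peak_le_one {p β : ℝ} (hp : 1 ≤ p) (hβ : -1 < β) {N : ℕ}
    (hN : β + 3 < N) :
    ∃ κ : ℝ, 0 < κ ∧ ∀ (u : Circle) (ρ : ℝ), 0 ≤ ρ → ρ < 1 →
      bergmanNorm p β (peak (κ * (1 - ρ) ^ (N - (2 + β) / p)) ρ u N) ≤ 1 := by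
  have hp0 : 0 < p := by linarith
  have hq : β + 3 < N * p := by nlinarith
  set K := max 1 (44 * 2 ^ |β| * (∫ x, radialProfile β (N * p - 2) x) * Real.pi) with hK
  have hK0 : 0 < K := lt_max_of_lt_left one_pos
  refine ⟨K ^ (-(1 / p)), by positivity, fun u ρ hρ0 hρ1 ↦ ?_⟩
  have hd : 0 < 1 - ρ := by linarith
  set A := K ^ (-(1 / p)) * (1 - ρ) ^ (N - (2 + β) / p) with hA
  have hA0 : 0 < A := by positivity
  have hAp : A ^ p = K⁻¹ * (1 - ρ) ^ (-(β + 2 - N * p)) := by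
    rw [hA, Real.mul_rpow (by positivity) (by positivity), ← Real.rpow_mul hK0.le,
      ← Real.rpow_mul hd.le, ← Real.rpow_neg_one]
    congr 2 <;> field_simp
    ring
  have hint : ∫ z in ball (0 : ℂ) 1, ‖peak A ρ u N z‖ ^ p * (1 - ‖z‖ ^ 2) ^ β
      = A ^ p * ∫ z in ball (0 : ℂ) 1,
        ‖1 - ρ * (((u⁻¹ : Circle) : ℂ) * z)‖ ^ (-(N * p)) * (1 - ‖z‖ ^ 2) ^ β := by
    rw [← MeasureTheory.integral_const_mul]
    congr 1
    ext z
    rw [peak, norm_mul, norm_inv, norm_pow, norm_real, Real.norm_of_nonneg hA0.le,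
      Real.mul_rpow hA0.le (by positivity), Real.inv_rpow (by positivity), ← Real.rpow_natCast,
      ← Real.rpow_mul (norm_nonneg _), Real.rpow_neg (norm_nonneg _), mul_assoc]
  have hle : ∫ z in ball (0 : ℂ) 1, ‖peak A ρ u N z‖ ^ p * (1 - ‖z‖ ^ 2) ^ β ≤ 1 := by
    rw [hint, hAp]
    calc _ ≤ K⁻¹ * (1 - ρ) ^ (-(β + 2 - N * p)) * (K * (1 - ρ) ^ (β + 2 - N * p)) := by
          gcongr
          refine (setIntegral_kernel_rotate_le hβ hq hρ0 hρ1 u⁻¹).trans ?_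
          gcongr
          exact le_max_right _ _
      _ = 1 := by
          rw [Real.rpow_neg hd.le]
          field_simp
  have h0 : 0 ≤ ∫ z in ball (0 : ℂ) 1, ‖peak A ρ u N z‖ ^ p * (1 - ‖z‖ ^ 2) ^ β := by
    refine MeasureTheory.setIntegral_nonneg measurableSet_ball fun z hz ↦ ?_
    have := mem_ball_zero_iff.mp hz
    exact mul_nonneg (by positivity) (Real.rpow_nonneg (by nlinarith [norm_nonneg z]) _)
  refine Real.rpow_le_one (by positivity) ?_ (by positivity)
  have : Real.pi⁻¹ ≤ 1 := inv_le_one_of_one_le₀ (by linarith [Real.pi_gt_three])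
  exact mul_le_one₀ this h0 hle

lemma exp_neg_two_le_pow_mul_pow (k : ℕ) :
    Real.exp (-2) ≤ ((k + 1 : ℝ) / (k + 2)) ^ k * ((k + 1 : ℝ) / (k + 2)) ^ k := by
  have hk : (0 : ℝ) < k + 1 := by positivity
  have h1 : (((k + 2 : ℝ) / (k + 1)) ^ k) ≤ Real.exp 1 := by
    calc ((k + 2 : ℝ) / (k + 1)) ^ k ≤ Real.exp (1 / (k + 1)) ^ k := by
          gcongr
          have := Real.add_one_le_exp (1 / (k + 1 : ℝ))
          refine le_trans (le_of_eq ?_) this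
          field_simp
          ring
      _ = Real.exp (k * (1 / (k + 1))) := by rw [Real.exp_nat_mul]
      _ ≤ Real.exp 1 := by
          gcongr
          rw [mul_one_div, div_le_one hk]
          linarith
  have h2 : Real.exp (-1) ≤ ((k + 1 : ℝ) / (k + 2)) ^ k := by
    rw [Real.exp_neg, ← inv_div, inv_pow]
    gcongr
  rw [show (-2 : ℝ) = -1 + -1 by norm_num, Real.exp_add]
  gcongr

lemma pow_div_factorial_le_choose (k N : ℕ) :
    (k + 1 : ℝ) ^ (N + 1) / (N + 1).factorial ≤ ((k + (N + 1)).choose (N + 1) : ℕ) := by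
  rw [div_le_iff₀ (by positivity)]
  have h := Nat.pow_succ_le_ascFactorial (k + 1) (N + 1)
  rw [Nat.ascFactorial_eq_factorial_mul_choose, mul_comm] at h
  exact_mod_cast h

lemma mul_rpow_le_of_mul_choose_le {k N : ℕ} {t r ρ s κ M : ℝ} (ht0 : 0 ≤ t) (ht1 : t < 1)
    (hr : r = (k + 1) / (k + 2)) (hρ : ρ = (t + r) / (1 + r * t)) (hs : s ≤ N) (hκ : 0 < κ)
    (h : κ * (1 - ρ) ^ (N - s) * ((1 - ρ * t) ^ N)⁻¹ *
      ((((k + (N + 1)).choose (N + 1) : ℕ) : ℝ) * r ^ k) ≤ (r ^ k)⁻¹ * M * (1 - r)⁻¹) :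
    κ * (4 ^ (N - s))⁻¹ * (2 ^ N)⁻¹ * Real.exp (-2) / (2 * (N + 1).factorial)
      * ((k + 1) / (1 - t)) ^ s ≤ M := by
  have hk : (0 : ℝ) < k + 1 := by positivity
  have hd : 0 < 1 - t := by linarith
  have hr0 : 0 < r := by rw [hr]; positivity
  have hr1 : 1 - r = 1 / (k + 2) := by rw [hr]; field_simp; ring
  have hr1' : r < 1 := by
    have : 0 < 1 - r := by rw [hr1]; positivity
    linarith
  have hrt : 0 < 1 + r * t := by positivity
  have hrt2 : 1 + r * t ≤ 2 := by nlinarith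
  have hρ1 : (1 - t) / (4 * (k + 1)) ≤ 1 - ρ := by
    have : 1 - ρ = 1 / (k + 2) * (1 - t) / (1 + r * t) := by
      rw [← hr1, hρ]
      field_simp
      ring
    rw [this, one_div_mul_eq_div, div_div]
    refine div_le_div_of_nonneg_left hd.le (by positivity) ?_
    nlinarith [show (0 : ℝ) ≤ k by positivity]
  have hρ0 : 0 < 1 - ρ := hρ1.trans_lt' (by positivity)
  have hρt : 1 - ρ * t = (1 - t ^ 2) / (1 + r * t) := by
    rw [hρ]
    field_simp
    ring
  have hρt0 : 0 < 1 - ρ * t := by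
    rw [hρt]
    exact div_pos (by nlinarith) hrt
  have hρt2 : 1 - ρ * t ≤ 2 * (1 - t) := by
    rw [hρt, div_le_iff₀ hrt]
    nlinarith [mul_nonneg hr0.le ht0]
  set X : ℝ := (k + 1) / (1 - t) with hX
  have hX0 : 0 < X := by positivity
  have e1 : (4 ^ (N - s))⁻¹ * (X ^ (N - s))⁻¹ ≤ (1 - ρ) ^ (N - s) := by
    rw [← mul_inv, ← Real.mul_rpow (by norm_num) hX0.le, ← Real.inv_rpow (by positivity)]
    refine Real.rpow_le_rpow (by positivity) (le_of_eq_of_le ?_ hρ1) (by linarith)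
    rw [hX]
    field_simp
  have e2 : (2 ^ N)⁻¹ * ((1 - t) ^ N)⁻¹ ≤ ((1 - ρ * t) ^ N)⁻¹ := by
    rw [← mul_inv, ← mul_pow]
    gcongr
  have e3 := pow_div_factorial_le_choose k N
  have e4 := exp_neg_two_le_pow_mul_pow k
  rw [← hr] at e4
  have hM : κ * (1 - ρ) ^ (N - s) * ((1 - ρ * t) ^ N)⁻¹ *
      (((k + (N + 1)).choose (N + 1) : ℕ) : ℝ) * (r ^ k * r ^ k) * (k + 2 : ℝ)⁻¹ ≤ M := by
    rw [hr1, one_div, inv_inv] at h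
    rw [← div_eq_mul_inv, div_le_iff₀ (by positivity)]
    calc _ = κ * (1 - ρ) ^ (N - s) * ((1 - ρ * t) ^ N)⁻¹ *
          ((((k + (N + 1)).choose (N + 1) : ℕ) : ℝ) * r ^ k) * r ^ k := by ring
      _ ≤ (r ^ k)⁻¹ * M * (k + 2) * r ^ k := by gcongr
      _ = M * (k + 2) := by field_simp
  have e5 : (2 * (k + 1) : ℝ)⁻¹ ≤ (k + 2 : ℝ)⁻¹ := by
    gcongr
    linarith [show (0 : ℝ) ≤ k by positivity]
  refine le_trans ?_ hM
  calc _ = κ * ((4 ^ (N - s))⁻¹ * (X ^ (N - s))⁻¹) * ((2 ^ N)⁻¹ * ((1 - t) ^ N)⁻¹) *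
        ((k + 1 : ℝ) ^ (N + 1) / (N + 1).factorial) * Real.exp (-2) * (2 * (k + 1) : ℝ)⁻¹ := by
        have hXs : X ^ s = (X ^ (N - s))⁻¹ * X ^ N := by
          rw [← Real.rpow_natCast, ← Real.rpow_neg hX0.le, ← Real.rpow_add hX0]
          ring_nf
        have hXN : X ^ N = (k + 1) ^ N * ((1 - t) ^ N)⁻¹ := by
          rw [hX, div_pow, div_eq_mul_inv]
        rw [hXs, hXN, pow_succ (k + 1 : ℝ) N]
        field_simp
    _ ≤ _ := by gcongr

end Extremal

/-- Lower bound in Theorem 2.1, weighted Bergman case: there is `c > 0` (depending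
only on `p, β`) such that for every `n ≥ 1` and `λ ∈ D` there is `f ∈ Hol(D)` with
`‖f‖_{A^p(β)} ≤ 1` and `‖f‖_{H^∞} < ∞` such that every bounded holomorphic `g`
interpolating `f` on the one-point sequence `(λ,…,λ)` of multiplicity `n`
satisfies `‖g‖_{H^∞} ≥ c (n/(1-|λ|))^{(2+β)/p}`. -/
theorem bergman_interpolation_lower_bound (p β : ℝ) (hp : 1 ≤ p) (hβ : -1 < β) :
    ∃ c : ℝ, 0 < c ∧
      ∀ (n : ℕ), 1 ≤ n → ∀ l : ℂ, ‖l‖ < 1 →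
      ∃ f : ℂ → ℂ, DifferentiableOn ℂ f (ball (0:ℂ) 1) ∧
        bergmanNorm p β f ≤ 1 ∧
        (∃ M : ℝ, ∀ z ∈ ball (0:ℂ) 1, ‖f z‖ ≤ M) ∧
        ∀ g h : ℂ → ℂ, DifferentiableOn ℂ g (ball (0:ℂ) 1) →
          DifferentiableOn ℂ h (ball (0:ℂ) 1) →
          (∀ z ∈ ball (0:ℂ) 1, f z - g z = (blaschkeF l z) ^ n * h z) →
          ∀ M : ℝ, (∀ z ∈ ball (0:ℂ) 1, ‖g z‖ ≤ M) →
            c * ((n : ℝ) / (1 - ‖l‖)) ^ ((2 + β) / p) ≤ M := by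
  have hp0 : 0 < p := by linarith
  obtain ⟨N, hN⟩ := exists_nat_gt (β + 3)
  obtain ⟨κ, hκ, hnorm⟩ := exists_bergmanNorm_peak_le_one hp hβ hN
  have hs : (2 + β) / p ≤ N := by
    rw [div_le_iff₀ hp0]
    nlinarith
  refine ⟨κ * (4 ^ (N - (2 + β) / p))⁻¹ * (2 ^ N)⁻¹ * Real.exp (-2)
    / (2 * (N + 1).factorial), by positivity, fun n hn l hl ↦ ?_⟩
  obtain ⟨k, rfl⟩ := Nat.exists_eq_add_of_le' hn
  set t := ‖l‖ with ht
  have ht0 : 0 ≤ t := norm_nonneg l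
  set u := Circle.exp (arg l)
  have hlu : l = t * u := by rw [Circle.coe_exp, norm_mul_exp_arg_mul_I]
  set r : ℝ := (k + 1) / (k + 2) with hr
  have hr0 : 0 < r := by positivity
  have hr1 : r < 1 := by
    rw [hr, div_lt_one (by positivity)]
    linarith
  set ρ := (t + r) / (1 + r * t) with hρ
  have hρ0 : 0 ≤ ρ := by positivity
  have hρ1 : ρ < 1 := by
    rw [hρ, div_lt_one (by positivity)]
    nlinarith
  have hd : 0 < 1 - ρ := by linarith
  set A := κ * (1 - ρ) ^ (N - (2 + β) / p) with hA
  have hA0 : 0 ≤ A := by positivity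
  have hρt : 0 < 1 - ρ * t := by nlinarith
  refine ⟨peak A ρ u N, differentiableOn_peak hρ0 hρ1 N, hnorm u ρ hρ0 hρ1,
    ⟨_, fun z hz ↦ norm_peak_le hA0 hρ0 hρ1 N (mem_ball_zero_iff.mp hz).le⟩,
    fun g h hg hh hfg M hM ↦ ?_⟩
  have hφ := differentiableOn_discAut (u := u) ht0 hl
  have hmaps := mapsTo_discAut (u := u) ht0 hl
  have key := choose_mul_pow_le_of_interpolates ht0 hr0 hr1 hr0.le hr1 N k
    (B := A * ((1 - ρ * t) ^ N)⁻¹) (by positivity) (G := fun w ↦ g (discAut u t w))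
    (H := fun w ↦ (-u : ℂ) ^ (k + 1) * h (discAut u t w)) (hg.comp hφ hmaps)
    ((hh.comp hφ hmaps).const_mul _) (fun w hw ↦ hM _ (hmaps hw)) fun w hw ↦ by
      have hw1 := (mem_ball_zero_iff.mp hw).le
      have e := hfg _ (hmaps hw)
      rw [hlu, blaschkeF_discAut ht0 hl hw1, peak_discAut N ht0 hl hr0.le hρ hw1, mul_pow] at e
      linear_combination e
  have := mul_rpow_le_of_mul_choose_le ht0 hl hr hρ hs hκ key
  exact_mod_cast this
end
end
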